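/- Assume the switching setup and that (A,B) ∈ ℝ^{n×n} × ℝ^{n×m} is controllable (the matrix [B, AB, …, A^{n−1}B] has rank n). If every complex eigenvalue μ of A satisfies Re(μ) < −(ln δ)/T_c, then there exist a gain matrix K ∈ ℝ^{m×n} and constants C > 0, ϱ > 0 such that every differentiable function x̄ : [0,∞) → ℝ^{Nn} satisfying x̄′(t) = (I_N ⊗ A − H_{σ(j)} ⊗ BK) x̄(t) for every j ∈ ℕ and every t ∈ [t_j, t_{j+1}) satisfies ‖x̄(t)‖ ≤ C e^{−ϱt} ‖x̄(0)‖ for all t ≥ 0. (Leader-following exponential consensus over jointly connected switching networks.) -/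

import Mathlib

open Matrix NormedSpace Kronecker

/-- The operator norm of a square real matrix induced by the Euclidean vector norm. -/
noncomputable def opNorm {k : Type*} [Fintype k] [DecidableEq k] (M : Matrix k k ℝ) : ℝ :=
  ‖Matrix.toEuclideanCLM (𝕜 := ℝ) M‖

/-- The product `f (b-1) * f (b-2) * ⋯ * f a` (the identity if `b ≤ a`):
later factors multiply on the left. -/
def descProd {R : Type*} [Monoid R] (f : ℕ → R) (a b : ℕ) : R :=
  ((List.range (b - a)).map (fun i => f (b - 1 - i))).prod

/-- The controllability matrix `[B, AB, …, A^{n-1}B]` of the pair `(A, B)`. -/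
def ctrbMatrix {n m : ℕ} (A : Matrix (Fin n) (Fin n) ℝ) (B : Matrix (Fin n) (Fin m) ℝ) :
    Matrix (Fin n) (Fin n × Fin m) ℝ :=
  Matrix.of fun i p => (A ^ (p.1 : ℕ) * B) i p.2

/-- The Euclidean norm of a finitely indexed real vector. -/
noncomputable def eNorm {ι : Type*} [Fintype ι] (v : ι → ℝ) : ℝ :=
  Real.sqrt (∑ i, v i ^ 2)

/-! ### Growth of the matrix exponential -/

section Growth

lemma norm_exp_le_exp_norm_real {R : Type*} [NormedRing R] [NormedAlgebra ℝ R] [CompleteSpace R]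
    [NormOneClass R] (x : R) : ‖exp x‖ ≤ Real.exp ‖x‖ := by
  have h1 : HasSum (fun k : ℕ => ((k.factorial : ℝ)⁻¹) • x ^ k) (exp x) :=
    exp_series_hasSum_exp' (𝕂 := ℝ) x
  have h2 : HasSum (fun k : ℕ => ((k.factorial : ℝ)⁻¹) • ‖x‖ ^ k) (Real.exp ‖x‖) := by
    rw [Real.exp_eq_exp_ℝ]
    exact exp_series_hasSum_exp' (𝕂 := ℝ) ‖x‖
  rw [← h1.tsum_eq, ← h2.tsum_eq]
  refine tsum_of_norm_bounded h2.summable.hasSum fun k => ?_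
  rw [norm_smul, smul_eq_mul, Real.norm_of_nonneg (by positivity)]
  gcongr
  exact norm_pow_le x k

/-- Exponential bounds on the semigroup `t ↦ exp (t • a)` from the spectral radius of `exp a`. -/
lemma exists_norm_exp_smul_le {R : Type*} [NormedRing R] [NormedAlgebra ℂ R] [CompleteSpace R]
    [NormOneClass R] (a : R) {α : ℝ} (hα : 0 ≤ α)
    (h : spectralRadius ℂ (exp a) < ENNReal.ofReal (Real.exp α)) :
    ∃ M : ℝ, 0 < M ∧ ∀ t : ℝ, 0 ≤ t → ‖exp (t • a)‖ ≤ M * Real.exp (α * t) := by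
  let _ : NormedAlgebra ℚ R := NormedAlgebra.restrictScalars ℚ ℝ R
  have hG := (spectrum.pow_norm_pow_one_div_tendsto_nhds_spectralRadius (exp a)).eventually_lt_const h
  obtain ⟨k₀, hk₀⟩ := Filter.eventually_atTop.1 hG
  obtain ⟨M₀, hM₀, hM⟩ : ∃ M₀ : ℝ, 0 < M₀ ∧ ∀ k : ℕ, ‖exp a ^ k‖ ≤ M₀ * Real.exp (α * k) := by
    have hs : 0 ≤ ∑ k ∈ Finset.range (k₀ + 1), ‖exp a ^ k‖ :=
      Finset.sum_nonneg fun _ _ => norm_nonneg _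
    refine ⟨1 + ∑ k ∈ Finset.range (k₀ + 1), ‖exp a ^ k‖, by linarith, fun k => ?_⟩
    have he : 1 ≤ Real.exp (α * k) := Real.one_le_exp (by positivity)
    rcases lt_or_ge k (k₀ + 1) with hk | hk
    · have := Finset.single_le_sum (f := fun k => ‖exp a ^ k‖) (fun _ _ => norm_nonneg _)
        (Finset.mem_range.2 hk)
      nlinarith
    · have hk1 := hk₀ k (by omega)
      rw [ENNReal.ofReal_lt_ofReal_iff (Real.exp_pos _)] at hk1
      have hk2 : (0 : ℝ) < k := by exact_mod_cast (by omega : 0 < k)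
      have : ‖exp a ^ k‖ ≤ Real.exp (α * k) := by
        calc ‖exp a ^ k‖ = (‖exp a ^ k‖ ^ (1 / (k : ℝ))) ^ (k : ℝ) := by
              rw [← Real.rpow_mul (norm_nonneg _), one_div_mul_cancel hk2.ne', Real.rpow_one]
          _ ≤ (Real.exp α) ^ (k : ℝ) := by gcongr
          _ = Real.exp (α * k) := by rw [← Real.exp_mul]
      nlinarith
  refine ⟨Real.exp ‖a‖ * M₀, by positivity, fun t ht => ?_⟩
  set k := ⌊t⌋₊
  have hk : (k : ℝ) ≤ t := Nat.floor_le ht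
  have hk' : t < k + 1 := Nat.lt_floor_add_one t
  have hdec : t • a = (t - k) • a + (k : ℕ) • a := by
    rw [← Nat.cast_smul_eq_nsmul ℝ k a, ← add_smul]; simp
  have hcomm : Commute ((t - k) • a) ((k : ℕ) • a) :=
    ((Commute.refl a).smul_left _).smul_right _
  rw [hdec, exp_add_of_commute hcomm, NormedSpace.exp_nsmul]
  calc _ ≤ ‖exp ((t - k) • a)‖ * ‖exp a ^ k‖ := norm_mul_le _ _
    _ ≤ Real.exp ‖a‖ * (M₀ * Real.exp (α * k)) := by
        gcongr
        · refine (norm_exp_le_exp_norm_real _).trans (Real.exp_le_exp.2 ?_)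
          rw [norm_smul, Real.norm_of_nonneg (by linarith)]
          exact mul_le_of_le_one_left (norm_nonneg _) (by linarith)
        · exact hM k
    _ ≤ Real.exp ‖a‖ * M₀ * Real.exp (α * t) := by
        rw [← mul_assoc]; gcongr

lemma LinearMap.exists_norm_le_mul_norm {V W : Type*} [NormedAddCommGroup V] [NormedSpace ℝ V]
    [FiniteDimensional ℝ V] [SeminormedAddCommGroup W] [NormedSpace ℝ W] (f : V →ₗ[ℝ] W) :
    ∃ C : ℝ, 0 < C ∧ ∀ x, ‖f x‖ ≤ C * ‖x‖ :=
  f.toContinuousLinearMap.bound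

attribute [local instance] Matrix.linftyOpNormedRing Matrix.linftyOpNormedAlgebra
  Matrix.linfty_opNormOneClass

lemma Matrix.exp_mulVec_of_mulVec_eq_smul {n : ℕ} (A : Matrix (Fin n) (Fin n) ℂ) {μ : ℂ}
    {w : Fin n → ℂ} (hw : A *ᵥ w = μ • w) : exp A *ᵥ w = Complex.exp μ • w := by
  have hpow : ∀ k : ℕ, (A ^ k) *ᵥ w = μ ^ k • w := by
    intro k
    induction k with
    | zero => simp
    | succ k ih => rw [pow_succ, ← Matrix.mulVec_mulVec, hw, Matrix.mulVec_smul, ih, smul_smul,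
        pow_succ, mul_comm]
  have h1 : HasSum (fun k : ℕ => ((k.factorial : ℂ)⁻¹) • A ^ k) (exp A) :=
    exp_series_hasSum_exp' (𝕂 := ℂ) A
  have h2 : HasSum (fun k : ℕ => ((k.factorial : ℂ)⁻¹) • μ ^ k) (Complex.exp μ) := by
    rw [Complex.exp_eq_exp_ℂ]
    exact exp_series_hasSum_exp' (𝕂 := ℂ) μ
  have h3 := h1.map ((Matrix.mulVecBilin ℂ ℂ).flip w : Matrix (Fin n) (Fin n) ℂ →ₗ[ℂ] (Fin n → ℂ))
    (continuous_id.matrix_mulVec continuous_const)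
  refine h3.unique ?_
  convert h2.smul_const w using 2 with k
  simp [hpow, smul_smul]

lemma Matrix.exists_eigenvector_of_mem_spectrum_exp {n : ℕ} (A : Matrix (Fin n) (Fin n) ℂ) {z : ℂ}
    (hz : z ∈ spectrum ℂ (exp A)) :
    ∃ μ : ℂ, ∃ w : Fin n → ℂ, w ≠ 0 ∧ A *ᵥ w = μ • w ∧ z = Complex.exp μ := by
  rw [← Matrix.spectrum_toLin', ← Module.End.hasEigenvalue_iff_mem_spectrum] at hz
  have hcomm : Commute (Matrix.toLin' (exp A)) (Matrix.toLin' A) := by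
    have : Commute (exp A) A := (Commute.refl A).exp_left
    exact this.map (Matrix.toLinAlgEquiv' : Matrix (Fin n) (Fin n) ℂ ≃ₐ[ℂ] _)
  have hmaps : ∀ x ∈ Module.End.eigenspace (Matrix.toLin' (exp A)) z,
      Matrix.toLin' A x ∈ Module.End.eigenspace (Matrix.toLin' (exp A)) z :=
    Module.End.mapsTo_genEigenspace_of_comm hcomm z 1
  have : Nontrivial (Module.End.eigenspace (Matrix.toLin' (exp A)) z) :=
    Submodule.nontrivial_iff_ne_bot.2 hz
  obtain ⟨μ, hμ⟩ := Module.End.exists_eigenvalue ((Matrix.toLin' A).restrict hmaps)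
  obtain ⟨w, hw⟩ := hμ.exists_hasEigenvector
  have hw0 : (w : Fin n → ℂ) ≠ 0 := fun h => hw.2 (Subtype.ext h)
  have hA : A *ᵥ (w : Fin n → ℂ) = μ • (w : Fin n → ℂ) := by
    have := congrArg Subtype.val hw.apply_eq_smul
    simpa using this
  have hE : exp A *ᵥ (w : Fin n → ℂ) = z • (w : Fin n → ℂ) := by
    have := Module.End.mem_eigenspace_iff.1 w.2
    simpa using this
  refine ⟨μ, w, hw0, hA, ?_⟩
  rw [Matrix.exp_mulVec_of_mulVec_eq_smul A hA] at hE
  exact (smul_left_injective ℂ hw0 hE).symm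

/-- If all complex eigenvalues of the real matrix `A` have real part less than `β`, then
`exp (t A)` grows strictly slower than `exp (β t)`, in every finite-dimensional representation. -/
lemma Matrix.exists_norm_exp_smul_algHom_le {n : ℕ} (hn : 1 ≤ n) (A : Matrix (Fin n) (Fin n) ℝ)
    {β : ℝ} (hβ : 0 < β)
    (hspec : ∀ μ : ℂ, (∃ v : Fin n → ℂ, v ≠ 0 ∧ (A.map (Complex.ofReal)).mulVec v = μ • v) →
      μ.re < β)
    {R : Type*} [NormedRing R] [NormedAlgebra ℝ R] [CompleteSpace R]
    (f : Matrix (Fin n) (Fin n) ℝ →ₐ[ℝ] R) :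
    ∃ α M : ℝ, 0 ≤ α ∧ α < β ∧ 0 < M ∧
      ∀ t : ℝ, 0 ≤ t → ‖exp (t • f A)‖ ≤ M * Real.exp (α * t) := by
  have : Nonempty (Fin n) := ⟨⟨0, hn⟩⟩
  let _ : NormedAlgebra ℚ R := NormedAlgebra.restrictScalars ℚ ℝ R
  set Ac : Matrix (Fin n) (Fin n) ℂ := A.map Complex.ofReal with hAc
  obtain ⟨z, hz, hzr⟩ := spectrum.exists_nnnorm_eq_spectralRadius (exp Ac)
  obtain ⟨μ, w, hw0, hw, rfl⟩ := Matrix.exists_eigenvector_of_mem_spectrum_exp Ac hz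
  have hμ : μ.re < β := hspec μ ⟨w, hw0, hw⟩
  obtain ⟨α, hα1, hα2⟩ := exists_between (max_lt hμ hβ)
  have hα0 : 0 ≤ α := (le_max_right _ _).trans hα1.le
  have hrad : spectralRadius ℂ (exp Ac) < ENNReal.ofReal (Real.exp α) := by
    rw [← hzr, ← enorm_eq_nnnorm, ← ofReal_norm, ENNReal.ofReal_lt_ofReal_iff (Real.exp_pos _),
      Complex.norm_exp, Real.exp_lt_exp]
    exact (le_max_left _ _).trans_lt hα1
  obtain ⟨M, hM0, hM⟩ := exists_norm_exp_smul_le Ac hα0 hrad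
  let _ : NormedAlgebra ℚ (Matrix (Fin n) (Fin n) ℝ) := NormedAlgebra.restrictScalars ℚ ℝ _
  obtain ⟨D, hD0, hD⟩ := f.toLinearMap.exists_norm_le_mul_norm
  have hcf : Continuous f := f.toLinearMap.continuous_of_finiteDimensional
  refine ⟨α, D * M, hα0, hα2, by positivity, fun t ht => ?_⟩
  have h1 : exp (t • f A) = f (exp (t • A)) := by
    rw [← map_smul]
    exact (map_exp f hcf (t • A)).symm
  have h2 : ‖exp (t • A)‖ = ‖exp (t • Ac)‖ := by
    have hcont : Continuous (Complex.ofRealHom.mapMatrix : Matrix (Fin n) (Fin n) ℝ →+* _) :=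
      continuous_id.matrix_map Complex.continuous_ofReal
    have h3 : (Complex.ofRealHom.mapMatrix : Matrix (Fin n) (Fin n) ℝ →+* _) (t • A) = t • Ac := by
      ext i k; simp [hAc]
    have h4 := map_exp _ hcont (t • A)
    rw [h3] at h4
    refine Eq.trans ?_ (congrArg norm h4)
    simp [Matrix.linfty_opNorm_def]
    rfl
  rw [h1, mul_assoc]
  refine (hD _).trans ?_
  gcongr
  rw [h2]
  exact hM t ht

end Growth

/-! ### Switched linear dynamics near a product of commuting projections -/

section Switched

open scoped RealInnerProductSpace

lemma descProd_self {R : Type*} [Monoid R] (f : ℕ → R) (a : ℕ) : descProd f a a = 1 := by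
  simp [descProd]

lemma descProd_succ {R : Type*} [Monoid R] (f : ℕ → R) {a b : ℕ} (h : a ≤ b) :
    descProd f a (b + 1) = f b * descProd f a b := by
  simp only [descProd]
  rw [show b + 1 - a = (b - a) + 1 by omega, List.range_succ_eq_map]
  simp only [List.map_cons, List.prod_cons, List.map_map]
  congr 3
  ext i
  simp only [Function.comp]
  congr 1
  omega

lemma map_descProd {R S : Type*} [Monoid R] [Monoid S] (φ : R →* S) (f : ℕ → R) (a b : ℕ) :
    φ (descProd f a b) = descProd (fun i => φ (f i)) a b := by
  simp [descProd, map_list_prod, Function.comp_def]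

lemma Commute.descProd_left {R : Type*} [Monoid R] {f : ℕ → R} {x : R}
    (h : ∀ i, Commute (f i) x) (a b : ℕ) : Commute (descProd f a b) x := by
  refine Commute.list_prod_left _ _ fun y hy => ?_
  obtain ⟨i, -, rfl⟩ := List.mem_map.1 hy
  exact h _

variable {E : Type*} [NormedAddCommGroup E] [InnerProductSpace ℝ E]

/-- Lyapunov decay of the component of the solution in `ker P`. -/
lemma inner_sub_apply_le_exp_of_hasDerivWithinAt {a h P S : E →L[ℝ] E} (hPa : Commute P a)
    (hPh : P * h = 0) (hhP : h * P = 0) (hPP : P * P = P)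
    (hS : ∀ x y, ⟪S x, y⟫ = ⟪x, S y⟫) {γ : ℝ}
    (hdiss : ∀ z, P z = 0 → ⟪S z, (a - h) z⟫ ≤ -γ * ⟪S z, z⟫)
    {x : ℝ → E} {u v : ℝ} (huv : u ≤ v) (hx : ContinuousOn x (Set.Icc u v))
    (hd : ∀ s ∈ Set.Ico u v, HasDerivWithinAt x ((a - h) (x s)) (Set.Ici s) s) :
    ⟪S (x v - P (x v)), x v - P (x v)⟫ ≤
      Real.exp (-2 * γ * (v - u)) * ⟪S (x u - P (x u)), x u - P (x u)⟫ := by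
  set z : ℝ → E := fun s => x s - P (x s) with hz
  have hzc : ContinuousOn z (Set.Icc u v) := hx.sub (P.continuous.comp_continuousOn hx)
  have hPz : ∀ s, P (z s) = 0 := fun s => by
    have : P (P (x s)) = P (x s) := congrArg (fun X : E →L[ℝ] E => X (x s)) hPP
    simp [hz, this]
  have hzd : ∀ s ∈ Set.Ico u v, HasDerivWithinAt z ((a - h) (z s)) (Set.Ici s) s := by
    intro s hs
    have h1 := (hd s hs).sub (P.hasFDerivAt.comp_hasDerivWithinAt s (hd s hs))
    have h2 : P (h (x s)) = 0 := congrArg (fun X : E →L[ℝ] E => X (x s)) hPh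
    have h3 : P (a (x s)) = a (P (x s)) := congrArg (fun X : E →L[ℝ] E => X (x s)) hPa.eq
    have h4 : h (P (x s)) = 0 := congrArg (fun X : E →L[ℝ] E => X (x s)) hhP
    refine h1.congr_deriv ?_
    simp only [hz, _root_.sub_apply, map_sub, h2, h3, h4]
  have hdV : ∀ s ∈ Set.Ico u v, HasDerivWithinAt (fun s => Real.exp (2 * γ * (s - u)) * ⟪S (z s), z s⟫)
      (Real.exp (2 * γ * (s - u)) * (2 * γ) * ⟪S (z s), z s⟫ +
        Real.exp (2 * γ * (s - u)) * (2 * ⟪S (z s), (a - h) (z s)⟫)) (Set.Ici s) s := by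
    intro s hs
    have h1 := (S.hasFDerivAt.comp_hasDerivWithinAt s (hzd s hs)).inner ℝ (hzd s hs)
    have h2 : HasDerivAt (fun s : ℝ => Real.exp (2 * γ * (s - u)))
        (Real.exp (2 * γ * (s - u)) * (2 * γ)) s := by
      simpa using (((hasDerivAt_id s).sub_const u).const_mul (2 * γ)).exp
    refine (h2.hasDerivWithinAt.mul h1).congr_deriv ?_
    rw [hS ((a - h) (z s)) (z s), real_inner_comm (S (z s))]
    simp only [Function.comp]
    ring
  have key := image_le_of_deriv_right_le_deriv_boundary
    (f := fun s => Real.exp (2 * γ * (s - u)) * ⟪S (z s), z s⟫) (a := u) (b := v)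
    (B := fun _ => ⟪S (z u), z u⟫) (B' := fun _ => 0) ?_ hdV (by simp) continuousOn_const
    (fun s _ => hasDerivWithinAt_const _ _ _) ?_ (Set.right_mem_Icc.2 huv)
  · have he : Real.exp (-2 * γ * (v - u)) * Real.exp (2 * γ * (v - u)) = 1 := by
      rw [← Real.exp_add]; ring_nf; exact Real.exp_zero
    calc ⟪S (z v), z v⟫ = Real.exp (-2 * γ * (v - u)) *
          (Real.exp (2 * γ * (v - u)) * ⟪S (z v), z v⟫) := by rw [← mul_assoc, he, one_mul]
      _ ≤ _ := mul_le_mul_of_nonneg_left key (Real.exp_pos _).le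
  · refine ContinuousOn.mul (by fun_prop) ?_
    exact (S.continuous.comp_continuousOn hzc).inner hzc
  · intro s _
    have h1 := hdiss (z s) (hPz s)
    have h2 := Real.exp_pos (2 * γ * (s - u))
    nlinarith

variable [CompleteSpace E]

lemma exp_add_smul_apply (a : E →L[ℝ] E) (s t : ℝ) (x : E) :
    exp ((s + t) • a) x = exp (s • a) (exp (t • a) x) := by
  let _ : NormedAlgebra ℚ (E →L[ℝ] E) := NormedAlgebra.restrictScalars ℚ ℝ _
  rw [add_smul, NormedSpace.exp_add_of_commute (((Commute.refl a).smul_left _).smul_right _)]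
  rfl

/-- A gauge equivalent to the norm in which `exp (s • a)`, composed with any operator commuting
with `a`, has no overshoot. -/
lemma exists_adapted_gauge (a : E →L[ℝ] E) {α M : ℝ}
    (hM : ∀ t : ℝ, 0 ≤ t → ‖exp (t • a)‖ ≤ M * Real.exp (α * t)) :
    ∃ ν : E → ℝ, (∀ x y, ν (x + y) ≤ ν x + ν y) ∧ (∀ x, ‖x‖ ≤ ν x) ∧ (∀ x, ν x ≤ M * ‖x‖) ∧
      ∀ (s : ℝ) (T : E →L[ℝ] E), 0 ≤ s → Commute T a → ∀ x,
        ν (exp (s • a) (T x)) ≤ ‖T‖ * Real.exp (α * s) * ν x := by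
  let F : E → Set.Ici (0 : ℝ) → ℝ := fun x t => Real.exp (-(α * t)) * ‖exp ((t : ℝ) • a) x‖
  have hb : ∀ x t, F x t ≤ M * ‖x‖ := fun x t => by
    calc F x t ≤ Real.exp (-(α * t)) * (M * Real.exp (α * t) * ‖x‖) := by
          refine mul_le_mul_of_nonneg_left ?_ (Real.exp_pos _).le
          exact ((exp ((t : ℝ) • a)).le_opNorm x).trans
            (mul_le_mul_of_nonneg_right (hM t t.2) (norm_nonneg _))
      _ = (Real.exp (-(α * t)) * Real.exp (α * t)) * (M * ‖x‖) := by ring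
      _ = M * ‖x‖ := by rw [← Real.exp_add]; simp
  have hbdd : ∀ x, BddAbove (Set.range (F x)) := fun x =>
    ⟨M * ‖x‖, by rintro _ ⟨t, rfl⟩; exact hb x t⟩
  have hle : ∀ x t, F x t ≤ ⨆ t, F x t := fun x t => le_ciSup (hbdd x) t
  have h0 : ∀ x, ‖x‖ ≤ ⨆ t, F x t := fun x => by
    have := hle x ⟨0, Set.mem_Ici.2 le_rfl⟩
    simpa [F] using this
  refine ⟨fun x => ⨆ t, F x t, fun x y => ?_, h0, fun x => ciSup_le (hb x),
    fun s T hs hT x => ?_⟩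
  · refine ciSup_le fun t => ?_
    refine le_trans ?_ (add_le_add (hle x t) (hle y t))
    simp only [F, map_add, ← mul_add]
    exact mul_le_mul_of_nonneg_left (norm_add_le _ _) (Real.exp_pos _).le
  · refine ciSup_le fun t => ?_
    have ht : (0 : ℝ) ≤ t := t.2
    have hc : exp ((t : ℝ) • a) (exp (s • a) (T x)) = T (exp (((t : ℝ) + s) • a) x) := by
      rw [← exp_add_smul_apply]
      have : Commute (exp (((t : ℝ) + s) • a)) T := (hT.symm.smul_left _).exp_left
      exact congrArg (fun X : E →L[ℝ] E => X x) this.eq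
    have := hle x ⟨t + s, add_nonneg ht hs⟩
    calc F (exp (s • a) (T x)) t
        ≤ Real.exp (-(α * t)) * (‖T‖ * ‖exp (((t : ℝ) + s) • a) x‖) := by
          simp only [F, hc]
          exact mul_le_mul_of_nonneg_left (T.le_opNorm _) (Real.exp_pos _).le
      _ = ‖T‖ * Real.exp (α * s) * F x ⟨t + s, add_nonneg ht hs⟩ := by
          have : Real.exp (-(α * t)) = Real.exp (α * s) * Real.exp (-(α * (t + s))) := by
            rw [← Real.exp_add]; ring_nf
          simp only [F, this]; ring
      _ ≤ _ := by gcongr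

lemma apply_eq_exp_of_hasDerivWithinAt {a h P : E →L[ℝ] E} (hPa : Commute P a) (hPh : P * h = 0)
    {x : ℝ → E} {u v : ℝ} (huv : u ≤ v) (hx : ContinuousOn x (Set.Icc u v))
    (hd : ∀ s ∈ Set.Ico u v, HasDerivWithinAt x ((a - h) (x s)) (Set.Ici s) s) :
    P (x v) = exp ((v - u) • a) (P (x u)) := by
  have hde : ∀ s : ℝ, HasDerivAt (fun s : ℝ => exp ((u - s) • a)) (-(exp ((u - s) • a) * a)) s := by
    intro s
    have h1 := hasDerivAt_exp_smul_const a (u - s)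
    have h2 := h1.scomp s ((hasDerivAt_id s).const_sub u)
    simpa [Function.comp_def] using h2
  have hconst := constant_of_has_deriv_right_zero (f := fun s => exp ((u - s) • a) (P (x s)))
    (a := u) (b := v) ?_ ?_ v (Set.right_mem_Icc.2 huv)
  · have : exp ((v - u) • a) (exp ((u - v) • a) (P (x v))) = exp ((v - u) • a) (P (x u)) := by
      simpa using congrArg (fun y => (exp ((v - u) • a) : E →L[ℝ] E) y) hconst
    rw [← exp_add_smul_apply] at this
    simpa using this
  · have hc : Continuous fun s : ℝ => exp ((u - s) • a) :=
      continuous_iff_continuousAt.2 fun s => (hde s).continuousAt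
    exact hc.continuousOn.clm_apply (P.continuous.comp_continuousOn hx)
  · intro s hs
    have h1 := (hde s).hasDerivWithinAt (s := Set.Ici s) |>.clm_apply
      (P.hasFDerivAt.comp_hasDerivWithinAt s (hd s hs))
    have h2 : P (h (x s)) = 0 := congrArg (fun X : E →L[ℝ] E => X (x s)) hPh
    have h3 : P (a (x s)) = a (P (x s)) := congrArg (fun X : E →L[ℝ] E => X (x s)) hPa.eq
    exact h1.congr_deriv (by simp [h2, h3])

/-- Over one dwell interval the solution is close to `exp ((v - u) • a) (P (x u))`. -/
lemma norm_sub_exp_apply_le_of_hasDerivWithinAt {a h P S : E →L[ℝ] E} (hPa : Commute P a)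
    (hPh : P * h = 0) (hhP : h * P = 0) (hPP : P * P = P) (hP1 : ∀ x, ‖x - P x‖ ≤ ‖x‖)
    (hS : ∀ x y, ⟪S x, y⟫ = ⟪x, S y⟫) {γ c₁ c₂ τ ε : ℝ} (hγ : 0 ≤ γ) (hc₁ : 0 < c₁)
    (hc₂ : 0 ≤ c₂) (hε : 0 ≤ ε)
    (hS₁ : ∀ z, c₁ * ‖z‖ ^ 2 ≤ ⟪S z, z⟫) (hS₂ : ∀ z, ⟪S z, z⟫ ≤ c₂ * ‖z‖ ^ 2)
    (hcond : c₂ * Real.exp (-2 * γ * τ) ≤ ε ^ 2 * c₁)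
    (hdiss : ∀ z, P z = 0 → ⟪S z, (a - h) z⟫ ≤ -γ * ⟪S z, z⟫)
    {x : ℝ → E} {u v : ℝ} (huv : u ≤ v) (hτ : τ ≤ v - u) (hx : ContinuousOn x (Set.Icc u v))
    (hd : ∀ s ∈ Set.Ico u v, HasDerivWithinAt x ((a - h) (x s)) (Set.Ici s) s) :
    ‖x v - exp ((v - u) • a) (P (x u))‖ ≤ ε * ‖x u‖ := by
  rw [← apply_eq_exp_of_hasDerivWithinAt hPa hPh huv hx hd]
  have h1 := inner_sub_apply_le_exp_of_hasDerivWithinAt hPa hPh hhP hPP hS hdiss huv hx hd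
  have h2 := hS₁ (x v - P (x v))
  have h3 := hS₂ (x u - P (x u))
  have h4 : Real.exp (-2 * γ * (v - u)) ≤ Real.exp (-2 * γ * τ) := by
    apply Real.exp_le_exp.2; nlinarith
  have h5 : ‖x u - P (x u)‖ ^ 2 ≤ ‖x u‖ ^ 2 := by gcongr; exact hP1 _
  refine abs_le_of_sq_le_sq' ?_ (by positivity) |>.2
  have h6 : c₁ * ‖x v - P (x v)‖ ^ 2 ≤ c₁ * (ε * ‖x u‖) ^ 2 := by
    calc _ ≤ Real.exp (-2 * γ * (v - u)) * ⟪S (x u - P (x u)), x u - P (x u)⟫ := h2.trans h1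
      _ ≤ Real.exp (-2 * γ * (v - u)) * (c₂ * ‖x u - P (x u)‖ ^ 2) := by gcongr
      _ ≤ Real.exp (-2 * γ * τ) * (c₂ * ‖x u‖ ^ 2) := by gcongr
      _ = (c₂ * Real.exp (-2 * γ * τ)) * ‖x u‖ ^ 2 := by ring
      _ ≤ (ε ^ 2 * c₁) * ‖x u‖ ^ 2 := by gcongr
      _ = _ := by ring
  exact le_of_mul_le_mul_left h6 hc₁

/-- Contraction over a block of switching intervals, up to a multiple of the one-step error. -/
lemma gauge_le_of_block {a : E →L[ℝ] E} {ν : E → ℝ} {α M ε Tc : ℝ} (hα : 0 ≤ α) (hM : 1 ≤ M)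
    (hε : 0 ≤ ε) (hε1 : ε ≤ 1)
    (hadd : ∀ x y, ν (x + y) ≤ ν x + ν y) (hν₁ : ∀ x, ‖x‖ ≤ ν x) (hν₂ : ∀ x, ν x ≤ M * ‖x‖)
    (hν : ∀ (s : ℝ) (T : E →L[ℝ] E), 0 ≤ s → Commute T a → ∀ x,
        ν (exp (s • a) (T x)) ≤ ‖T‖ * Real.exp (α * s) * ν x)
    {P : ℕ → E →L[ℝ] E} (hPa : ∀ r, Commute (P r) a) (hP1 : ∀ r, ‖P r‖ ≤ 1)
    {X : ℕ → E} {t : ℕ → ℝ} (ht : Monotone t)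
    (hstep : ∀ r, ‖X (r + 1) - exp ((t (r + 1) - t r) • a) (P r (X r))‖ ≤ ε * ‖X r‖)
    {p q L : ℕ} (hpq : p ≤ q) (hL : q - p ≤ L) (hTc : t q - t p ≤ Tc) :
    ν (X q) ≤ (‖descProd P p q‖ * Real.exp (α * Tc) +
      ε * (L * M * (Real.exp (α * Tc) + M) ^ L)) * ν (X p) := by
  set g := Real.exp (α * Tc) + M with hg
  have hg1 : 1 ≤ g := by have := Real.exp_pos (α * Tc); linarith
  have hν0 : ∀ x, 0 ≤ ν x := fun x => (norm_nonneg x).trans (hν₁ x)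
  have herr : ∀ r, ν (X (r + 1) - exp ((t (r + 1) - t r) • a) (P r (X r))) ≤ M * ε * ν (X r) := by
    intro r
    refine (hν₂ _).trans ?_
    rw [mul_assoc]
    gcongr
    exact (hstep r).trans (by gcongr; exact hν₁ _)
  have hexp : ∀ i, p + i + 1 ≤ q → Real.exp (α * (t (p + i + 1) - t (p + i))) ≤ Real.exp (α * Tc) := by
    intro i hi
    apply Real.exp_le_exp.2
    have h1 := ht hi
    have h2 := ht (Nat.le_add_right p i)
    exact mul_le_mul_of_nonneg_left (by linarith) hα
  have key : ∀ i, p + i ≤ q → ν (X (p + i)) ≤ g ^ i * ν (X p) ∧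
      ν (X (p + i) - exp ((t (p + i) - t p) • a) (descProd P p (p + i) (X p))) ≤
        ε * (i * M * g ^ i) * ν (X p) := by
    intro i
    induction i with
    | zero =>
      intro _
      have h0 : ν 0 ≤ 0 := by simpa using hν₂ 0
      simpa [descProd_self] using h0
    | succ i ih =>
      intro hi
      obtain ⟨h1, h2⟩ := ih (by omega)
      have hE := hexp i (by omega)
      have hti : 0 ≤ t (p + i + 1) - t (p + i) := sub_nonneg.2 (ht (by omega))
      have hPi : ∀ y, ν (exp ((t (p + i + 1) - t (p + i)) • a) (P (p + i) y)) ≤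
          Real.exp (α * Tc) * ν y := fun y => by
        refine (hν _ _ hti (hPa _) y).trans ?_
        gcongr
        · exact hν0 y
        · calc _ ≤ 1 * Real.exp (α * Tc) := by gcongr; exact hP1 _
            _ = _ := one_mul _
      have he := herr (p + i)
      rw [← add_assoc]
      constructor
      · calc ν (X (p + i + 1))
            = ν (exp ((t (p + i + 1) - t (p + i)) • a) (P (p + i) (X (p + i))) +
              (X (p + i + 1) - exp ((t (p + i + 1) - t (p + i)) • a) (P (p + i) (X (p + i))))) := by
              congr 1; abel
          _ ≤ Real.exp (α * Tc) * ν (X (p + i)) + M * ε * ν (X (p + i)) :=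
              (hadd _ _).trans (add_le_add (hPi _) he)
          _ ≤ Real.exp (α * Tc) * ν (X (p + i)) + M * ν (X (p + i)) := by
              have := hν0 (X (p + i))
              gcongr
              exact mul_le_of_le_one_right (by linarith) hε1
          _ = g * ν (X (p + i)) := by rw [hg]; ring
          _ ≤ g * (g ^ i * ν (X p)) := by gcongr
          _ = _ := by ring
      · have hsplit : X (p + i + 1) - exp ((t (p + i + 1) - t p) • a)
              (descProd P p (p + i + 1) (X p)) =
            exp ((t (p + i + 1) - t (p + i)) • a) (P (p + i)
              (X (p + i) - exp ((t (p + i) - t p) • a) (descProd P p (p + i) (X p)))) +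
            (X (p + i + 1) - exp ((t (p + i + 1) - t (p + i)) • a) (P (p + i) (X (p + i)))) := by
          have hc : Commute (P (p + i)) (exp ((t (p + i) - t p) • a)) :=
            ((hPa _).smul_right _).exp_right
          have hc' : ∀ y, P (p + i) (exp ((t (p + i) - t p) • a) y) =
              exp ((t (p + i) - t p) • a) (P (p + i) y) := fun y =>
            congrArg (fun Y : E →L[ℝ] E => Y y) hc.eq
          rw [map_sub, map_sub, hc', ← exp_add_smul_apply, descProd_succ P (Nat.le_add_right p i)]
          simp
        rw [hsplit]
        have hg0 : 0 ≤ g ^ i := by positivity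
        have hXp := hν0 (X p)
        calc _ ≤ Real.exp (α * Tc) * (ε * (i * M * g ^ i) * ν (X p)) + M * ε * (g ^ i * ν (X p)) := by
              refine (hadd _ _).trans (add_le_add ((hPi _).trans (by gcongr)) (he.trans ?_))
              gcongr
          _ ≤ g * (ε * (i * M * g ^ i) * ν (X p)) + M * ε * (g * g ^ i * ν (X p)) := by
              gcongr
              · rw [hg]; linarith
              · exact le_mul_of_one_le_left hg0 hg1
          _ = _ := by push_cast; ring
  obtain ⟨i, rfl⟩ := Nat.exists_eq_add_of_le hpq
  have hi := (key i le_rfl).2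
  have hiL : i ≤ L := by omega
  have hXp := hν0 (X p)
  have hmain := hν (t (p + i) - t p) (descProd P p (p + i)) (sub_nonneg.2 (ht (by omega)))
    (Commute.descProd_left hPa _ _) (X p)
  calc ν (X (p + i))
      = ν (exp ((t (p + i) - t p) • a) (descProd P p (p + i) (X p)) +
        (X (p + i) - exp ((t (p + i) - t p) • a) (descProd P p (p + i) (X p)))) := by
          congr 1; abel
    _ ≤ ‖descProd P p (p + i)‖ * Real.exp (α * Tc) * ν (X p) +
        ε * (L * M * g ^ L) * ν (X p) := by
          refine (hadd _ _).trans (add_le_add (hmain.trans ?_) (hi.trans ?_))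
          · gcongr
          · have : g ^ i ≤ g ^ L := pow_le_pow_right₀ hg1 hiL
            gcongr
    _ = _ := by ring

end Switched

/-! ### Lyapunov equations and high-decay feedback -/

section Lyapunov

open scoped RealInnerProductSpace
open ContinuousLinearMap (adjoint)

variable {F : Type*} [NormedAddCommGroup F] [InnerProductSpace ℝ F] [CompleteSpace F]

lemma norm_exp_smul_neg_add_le [Nontrivial F] (A : F →L[ℝ] F) {γ : ℝ} (hγ : ‖A‖ + 1 / 2 ≤ γ)
    {s : ℝ} (hs : 0 ≤ s) : ‖exp (s • -(A + γ • (1 : F →L[ℝ] F)))‖ ≤ Real.exp (-s / 2) := by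
  let _ : NormedAlgebra ℚ (F →L[ℝ] F) := NormedAlgebra.restrictScalars ℚ ℝ _
  have h1 : s • -(A + γ • (1 : F →L[ℝ] F)) =
      algebraMap ℝ (F →L[ℝ] F) (-(s * γ)) + s • -A := by
    rw [Algebra.algebraMap_eq_smul_one]
    simp only [smul_neg, smul_add, neg_add, neg_smul, smul_smul]
    abel
  rw [h1, NormedSpace.exp_add_of_commute (Algebra.commutes _ _)]
  have h2 : exp (algebraMap ℝ (F →L[ℝ] F) (-(s * γ))) =
      algebraMap ℝ (F →L[ℝ] F) (Real.exp (-(s * γ))) := by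
    rw [Real.exp_eq_exp_ℝ]
    exact (NormedSpace.algebraMap_exp_comm (𝕂 := ℝ) (-(s * γ))).symm
  rw [h2]
  calc _ ≤ ‖algebraMap ℝ (F →L[ℝ] F) (Real.exp (-(s * γ)))‖ * ‖exp (s • -A)‖ := norm_mul_le _ _
    _ ≤ Real.exp (-(s * γ)) * Real.exp ‖s • -A‖ := by
        rw [norm_algebraMap', Real.norm_of_nonneg (Real.exp_pos _).le]
        gcongr
        exact norm_exp_le_exp_norm_real _
    _ ≤ _ := by
        rw [← Real.exp_add, norm_smul, norm_neg, Real.norm_of_nonneg hs]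
        apply Real.exp_le_exp.2
        nlinarith

/-- The shifted Lyapunov equation has a positive solution, bounded uniformly in the shift. -/
lemma exists_lyapunov_solution [Nontrivial F] (A Q : F →L[ℝ] F) (hQ : Q.IsPositive) {γ : ℝ}
    (hγ : ‖A‖ + 1 / 2 ≤ γ) :
    ∃ W : F →L[ℝ] F, W.IsPositive ∧ ‖W‖ ≤ ‖Q‖ ∧
      (A + γ • 1) * W + W * (adjoint A + γ • 1) = Q := by
  set M : F →L[ℝ] F := A + γ • 1 with hM
  have hM' : adjoint M = adjoint A + γ • 1 := by
    rw [hM, ← ContinuousLinearMap.star_eq_adjoint, ← ContinuousLinearMap.star_eq_adjoint, star_add,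
      star_smul, star_one, star_trivial γ]
  set Φ : ℝ → F →L[ℝ] F := fun s => exp (s • -M) * (Q * exp (s • -adjoint M)) with hΦ
  have hadj : ∀ s : ℝ, exp (s • -adjoint M) = adjoint (exp (s • -M)) := fun s => by
    rw [← ContinuousLinearMap.star_eq_adjoint, ← ContinuousLinearMap.star_eq_adjoint,
      NormedSpace.star_exp]
    simp
  have hpos : ∀ s, (Φ s).IsPositive := fun s => by
    have := hQ.conj_adjoint (exp (s • -M))
    rw [← hadj] at this
    exact this
  have hnorm : ∀ s ∈ Set.Ioi (0 : ℝ), ‖Φ s‖ ≤ ‖Q‖ * Real.exp (-s) := fun s hs => by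
    have h1 := norm_exp_smul_neg_add_le A hγ (le_of_lt hs)
    have h2 : ‖exp (s • -adjoint M)‖ ≤ Real.exp (-s / 2) := by
      rw [hadj, LinearIsometryEquiv.norm_map]; exact h1
    calc ‖Φ s‖ ≤ ‖exp (s • -M)‖ * (‖Q‖ * ‖exp (s • -adjoint M)‖) :=
          (norm_mul_le _ _).trans (by gcongr; exact norm_mul_le _ _)
      _ ≤ Real.exp (-s / 2) * (‖Q‖ * Real.exp (-s / 2)) := by gcongr
      _ = ‖Q‖ * (Real.exp (-s / 2) * Real.exp (-s / 2)) := by ring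
      _ = _ := by rw [← Real.exp_add]; ring_nf
  have hderiv : ∀ s, HasDerivAt Φ (-(M * Φ s + Φ s * adjoint M)) s := fun s => by
    refine ((hasDerivAt_exp_smul_const' (-M) s).mul
      ((hasDerivAt_exp_smul_const (-adjoint M) s).const_mul Q)).congr_deriv ?_
    simp only [hΦ]
    noncomm_ring
  have hcont : Continuous Φ := continuous_iff_continuousAt.2 fun s => (hderiv s).continuousAt
  have hbi : MeasureTheory.IntegrableOn (fun s => ‖Q‖ * Real.exp (-s)) (Set.Ioi 0) :=
    (integrableOn_exp_neg_Ioi 0).const_mul _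
  have hae : ∀ᵐ s ∂(MeasureTheory.volume.restrict (Set.Ioi (0 : ℝ))),
      ‖Φ s‖ ≤ ‖Q‖ * Real.exp (-s) := by
    filter_upwards [MeasureTheory.ae_restrict_mem measurableSet_Ioi] with s hs using hnorm s hs
  have hinteg : MeasureTheory.IntegrableOn Φ (Set.Ioi 0) :=
    MeasureTheory.Integrable.mono' hbi hcont.aestronglyMeasurable hae
  have happ : ∀ x y, ⟪(∫ s in Set.Ioi (0 : ℝ), Φ s) x, y⟫ = ∫ s in Set.Ioi (0 : ℝ), ⟪Φ s x, y⟫ := by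
    intro x y
    rw [ContinuousLinearMap.integral_apply hinteg, real_inner_comm, ← integral_inner]
    · simp_rw [real_inner_comm y]
    · exact (ContinuousLinearMap.apply ℝ F x).integrable_comp hinteg
  refine ⟨∫ s in Set.Ioi (0 : ℝ), Φ s, ?_, ?_, ?_⟩
  · rw [ContinuousLinearMap.isPositive_iff]
    refine ⟨fun x y => ?_, fun x => ?_⟩
    · change ⟪(∫ s in Set.Ioi (0 : ℝ), Φ s) x, y⟫ = ⟪x, (∫ s in Set.Ioi (0 : ℝ), Φ s) y⟫
      rw [real_inner_comm _ x, happ, happ]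
      refine MeasureTheory.integral_congr_ae (Filter.Eventually.of_forall fun s => ?_)
      change ⟪Φ s x, y⟫ = ⟪Φ s y, x⟫
      rw [real_inner_comm x]
      exact (hpos s).isSymmetric x y
    · rw [happ]
      exact MeasureTheory.integral_nonneg fun s => (hpos s).inner_nonneg_left x
  · refine (MeasureTheory.norm_integral_le_of_norm_le hbi hae).trans ?_
    rw [MeasureTheory.integral_const_mul, integral_exp_neg_Ioi_zero, mul_one]
  · let Λ : (F →L[ℝ] F) →L[ℝ] (F →L[ℝ] F) :=
      -(ContinuousLinearMap.mul ℝ (F →L[ℝ] F) M +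
        (ContinuousLinearMap.mul ℝ (F →L[ℝ] F)).flip (adjoint M))
    have hΛ : ∀ X, Λ X = -(M * X + X * adjoint M) := fun X => by
      simp only [Λ, _root_.neg_apply, _root_.add_apply,
        ContinuousLinearMap.flip_apply, ContinuousLinearMap.mul_apply']
    have htend : Filter.Tendsto Φ Filter.atTop (nhds 0) := by
      refine squeeze_zero_norm' (a := fun s => ‖Q‖ * Real.exp (-s)) ?_ ?_
      · filter_upwards [Filter.eventually_gt_atTop 0] with s hs using hnorm s hs
      · simpa using (Real.tendsto_exp_neg_atTop_nhds_zero).const_mul ‖Q‖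
    have h1 := MeasureTheory.integral_Ioi_of_hasDerivAt_of_tendsto (f := Φ)
      (f' := fun s => Λ (Φ s)) (a := 0) (m := 0) hcont.continuousWithinAt
      (fun s _ => (hderiv s).congr_deriv (hΛ _).symm) (Λ.integrable_comp hinteg) htend
    rw [Λ.integral_comp_comm hinteg, hΛ] at h1
    have h2 : Φ 0 = Q := by simp [hΦ]
    rw [h2, zero_sub, neg_inj, hM'] at h1
    exact h1

end Lyapunov

section Gain

open scoped RealInnerProductSpace
open ContinuousLinearMap (adjoint)

variable {F G : Type*} [NormedAddCommGroup F] [InnerProductSpace ℝ F]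
  [NormedAddCommGroup G] [InnerProductSpace ℝ G]

lemma ContinuousLinearMap.IsPositive.norm_apply_sq_le {W : F →L[ℝ] F} (hW : W.IsPositive) (x : F) :
    ‖W x‖ ^ 2 ≤ ‖W‖ * ⟪W x, x⟫ := by
  rcases eq_or_ne ‖W‖ 0 with h | h
  · have : W = 0 := norm_eq_zero.1 h
    simp [this]
  have hw : 0 < ‖W‖ := lt_of_le_of_ne (norm_nonneg _) h.symm
  have h1 := hW.inner_nonneg_left (x - ‖W‖⁻¹ • W x)
  have h2 : ⟪W (W x), x⟫ = ‖W x‖ ^ 2 := by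
    rw [← real_inner_self_eq_norm_sq]
    exact hW.isSymmetric (W x) x
  have h3 : ⟪W (W x), W x⟫ ≤ ‖W‖ * ‖W x‖ ^ 2 := by
    refine (real_inner_le_norm _ _).trans ?_
    nlinarith [W.le_opNorm (W x), norm_nonneg (W x)]
  simp only [map_sub, map_smul, inner_sub_left, inner_sub_right, inner_smul_left,
    inner_smul_right, h2, real_inner_self_eq_norm_sq] at h1
  simp only [conj_trivial] at h1
  have h4 : ‖W‖⁻¹ * (‖W‖⁻¹ * ⟪W (W x), W x⟫) ≤ ‖W‖⁻¹ * ‖W x‖ ^ 2 := by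
    gcongr
    rw [inv_mul_le_iff₀ hw]; exact h3
  have h5 : ‖W‖⁻¹ * ‖W x‖ ^ 2 ≤ ⟪W x, x⟫ := by linarith
  rwa [inv_mul_le_iff₀ hw] at h5

lemma pow_le_of_sq_le_mul {q b : ℕ → ℝ} {g κ : ℝ} {n : ℕ} (hg : 1 ≤ g) (hκ : 0 ≤ κ) (hκg : κ ≤ g)
    (hq0 : ∀ k, 0 ≤ q k) (hq : ∀ k < n, q (k + 1) ^ 2 ≤ g * q k)
    (hb : ∀ k < n, b k ^ 2 ≤ g * q k) (h : ∃ k < n, κ ≤ b k) : (κ / g) ^ 2 ^ n ≤ q 0 := by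
  have hg0 : 0 < g := by linarith
  have hp : ∀ k ≤ n, (q k / g) ^ 2 ^ k ≤ q 0 / g := by
    intro k
    induction k with
    | zero => intro _; simp
    | succ k ih =>
      intro hk
      refine le_trans ?_ (ih (by omega))
      rw [pow_succ' 2 k, pow_mul]
      have h1 : (q (k + 1) / g) ^ 2 ≤ q k / g := by
        rw [div_pow, div_le_div_iff₀ (by positivity) hg0]
        nlinarith [hq k (by omega)]
      gcongr
  obtain ⟨k, hk, hkκ⟩ := h
  have h1 : (κ / g) ^ 2 ≤ q k / g := by
    rw [div_pow, div_le_div_iff₀ (by positivity) hg0]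
    have h2 : κ ^ 2 ≤ b k ^ 2 := by gcongr
    nlinarith [hb k hk]
  calc (κ / g) ^ 2 ^ n ≤ (κ / g) ^ 2 ^ (k + 1) :=
        pow_le_pow_of_le_one (by positivity) ((div_le_one hg0).2 hκg)
          (Nat.pow_le_pow_right (by norm_num) hk)
    _ = ((κ / g) ^ 2) ^ 2 ^ k := by rw [pow_succ' 2 k, pow_mul]
    _ ≤ (q k / g) ^ 2 ^ k := by gcongr
    _ ≤ q 0 / g := hp k hk.le
    _ ≤ q 0 := div_le_self (hq0 0) hg

variable [CompleteSpace F] [CompleteSpace G]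

/-- Observability bounds solutions of the shifted Lyapunov equation from below, polynomially in
the shift. -/
lemma exists_le_norm_lyapunov_solution (A : F →L[ℝ] F) (D : F →L[ℝ] G) (n : ℕ) {κ : ℝ}
    (hκ : 0 < κ)
    (hobs : ∀ x : F, ‖x‖ = 1 → ∃ k < n, κ ≤ ‖D ((adjoint A ^ k) x)‖) :
    ∃ c : ℝ, 0 < c ∧ ∀ (γ : ℝ) (W : F →L[ℝ] F), 1 ≤ γ → ‖A‖ ≤ γ → W.IsPositive →
      ‖W‖ ≤ ‖adjoint D ∘L D‖ →
      (A + γ • 1) * W + W * (adjoint A + γ • 1) = adjoint D ∘L D →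
      ∀ x, (c / γ ^ 2) ^ 2 ^ n * ‖x‖ ≤ ‖W x‖ := by
  set a := adjoint A with ha
  have hna : ‖a‖ = ‖A‖ := LinearIsometryEquiv.norm_map _ _
  set q₀ := ‖adjoint D ∘L D‖
  set Y := (1 + ‖A‖) ^ n with hY
  have hY1 : 1 ≤ Y := one_le_pow₀ (by linarith [norm_nonneg A])
  set g₀ := 8 * ‖D‖ ^ 2 * Y + 18 * q₀ * Y + 4 * Y with hg₀
  have hq₀ : 0 ≤ q₀ := norm_nonneg _
  have hg₀1 : 1 ≤ g₀ := by
    have : 0 ≤ ‖D‖ ^ 2 * Y := by positivity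
    have : 0 ≤ q₀ * Y := by positivity
    linarith
  set κ' := min κ 1 with hκ'
  have hκ'0 : 0 < κ' := lt_min hκ one_pos
  refine ⟨κ' / g₀, by positivity, fun γ W hγ1 hγA hW hWn hL => ?_⟩
  set g := g₀ * γ ^ 2 with hg
  have hg1 : 1 ≤ g := by nlinarith
  have hunit : ∀ x : F, ‖x‖ = 1 → (κ' / g) ^ 2 ^ n ≤ ‖W x‖ := by
    intro x hx
    have hy : ∀ k ≤ n, ‖(a ^ k) x‖ ≤ Y := fun k hk => by
      calc ‖(a ^ k) x‖ ≤ ‖a ^ k‖ * ‖x‖ := (a ^ k).le_opNorm x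
        _ ≤ ‖a‖ ^ k := by
          rw [hx, mul_one]
          rcases Nat.eq_zero_or_pos k with rfl | hk'
          · exact ContinuousLinearMap.norm_id_le
          · exact norm_pow_le' _ hk'
        _ ≤ (1 + ‖A‖) ^ k := by rw [hna]; gcongr; linarith
        _ ≤ _ := pow_le_pow_right₀ (by linarith [norm_nonneg A]) hk
    have hLy : ∀ y, A (W y) + γ • W y + (W (a y) + γ • W y) = adjoint D (D y) := fun y => by
      have := congrArg (fun X : F →L[ℝ] F => X y) hL
      simpa using this
    have hb : ∀ k ≤ n, ‖D ((a ^ k) x)‖ ^ 2 ≤ 4 * Y * γ * ‖W ((a ^ k) x)‖ := by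
      intro k hk
      set y := (a ^ k) x
      have h1 : ‖D y‖ ^ 2 = 2 * ⟪W y, a y + γ • y⟫ := by
        have h2 : ⟪adjoint D (D y), y⟫ = ‖D y‖ ^ 2 := by
          rw [ContinuousLinearMap.adjoint_inner_left, real_inner_self_eq_norm_sq]
        have h3 : ⟪A (W y), y⟫ = ⟪W y, a y⟫ := (ContinuousLinearMap.adjoint_inner_right A _ _).symm
        have h4 : ⟪W (a y), y⟫ = ⟪W y, a y⟫ := by
          rw [real_inner_comm (a y)]
          exact (hW.isSymmetric (a y) y).trans (by rfl)
        rw [← h2, ← hLy y]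
        simp only [inner_add_left, inner_add_right, inner_smul_left, inner_smul_right, h3, h4]
        simp
        ring
      have h5 : ‖a y + γ • y‖ ≤ 2 * γ * Y := by
        calc ‖a y + γ • y‖ ≤ ‖a‖ * ‖y‖ + γ * ‖y‖ := by
              refine (norm_add_le _ _).trans (add_le_add (a.le_opNorm y) ?_)
              rw [norm_smul, Real.norm_of_nonneg (by linarith)]
          _ = (‖A‖ + γ) * ‖y‖ := by rw [hna]; ring
          _ ≤ (γ + γ) * Y := by gcongr; exact hy k hk
          _ = _ := by ring
      calc ‖D y‖ ^ 2 ≤ 2 * (‖W y‖ * (2 * γ * Y)) := by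
            rw [h1]
            gcongr
            exact (real_inner_le_norm _ _).trans (by gcongr)
        _ = _ := by ring
    have hq : ∀ k ≤ n, ‖W ((a ^ (k + 1)) x)‖ ^ 2 ≤ g * ‖W ((a ^ k) x)‖ := by
      intro k hk
      have h1 := hb k hk
      have hs : (a ^ (k + 1)) x = a ((a ^ k) x) := by rw [pow_succ']; rfl
      rw [hs]
      have hWy : ‖W ((a ^ k) x)‖ ≤ q₀ * Y :=
        (W.le_opNorm _).trans (by gcongr; exact hy k hk)
      set y := (a ^ k) x
      have h2 : W (a y) = adjoint D (D y) - (A (W y) + (2 * γ) • W y) := by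
        rw [← hLy y, two_mul, add_smul]; abel
      have h3 : ‖W (a y)‖ ≤ ‖D‖ * ‖D y‖ + 3 * γ * ‖W y‖ := by
        calc ‖W (a y)‖ ≤ ‖adjoint D (D y)‖ + (‖A (W y)‖ + ‖(2 * γ) • W y‖) := by
              rw [h2]
              exact (norm_sub_le _ _).trans (by gcongr; exact norm_add_le _ _)
          _ ≤ ‖D‖ * ‖D y‖ + (γ * ‖W y‖ + 2 * γ * ‖W y‖) := by
              gcongr
              · exact ((adjoint D).le_opNorm _).trans (by rw [LinearIsometryEquiv.norm_map])
              · exact (A.le_opNorm _).trans (by gcongr)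
              · rw [norm_smul, Real.norm_of_nonneg (by linarith)]
          _ = _ := by ring
      have hWy0 := norm_nonneg (W y)
      have hDD : 0 ≤ ‖D‖ ^ 2 * Y * ‖W y‖ := by positivity
      have hqY : 0 ≤ Y * ‖W y‖ := by positivity
      have hγγ : γ ≤ γ ^ 2 := by nlinarith
      calc ‖W (a y)‖ ^ 2 ≤ (‖D‖ * ‖D y‖ + 3 * γ * ‖W y‖) ^ 2 := by gcongr
        _ ≤ 2 * (‖D‖ * ‖D y‖) ^ 2 + 2 * (3 * γ * ‖W y‖) ^ 2 := by
            nlinarith [sq_nonneg (‖D‖ * ‖D y‖ - 3 * γ * ‖W y‖)]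
        _ = 2 * ‖D‖ ^ 2 * ‖D y‖ ^ 2 + 18 * γ ^ 2 * ‖W y‖ * ‖W y‖ := by ring
        _ ≤ 2 * ‖D‖ ^ 2 * (4 * Y * γ ^ 2 * ‖W y‖) + 18 * γ ^ 2 * ‖W y‖ * (q₀ * Y) := by
            gcongr
            exact h1.trans (by gcongr)
        _ ≤ _ := by
            rw [hg, hg₀]
            have : 0 ≤ 4 * Y * γ ^ 2 * ‖W y‖ := by positivity
            linarith
    have h4 : 4 * Y * γ ≤ g := by
      have h5 : 0 ≤ ‖D‖ ^ 2 * Y := by positivity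
      have h6 : 0 ≤ q₀ * Y := by positivity
      calc 4 * Y * γ ≤ g₀ * γ := by gcongr; linarith
        _ ≤ g₀ * γ ^ 2 := by gcongr; nlinarith
    obtain ⟨k, hk, hkκ⟩ := hobs x hx
    have := pow_le_of_sq_le_mul (q := fun k => ‖W ((a ^ k) x)‖) (b := fun k => ‖D ((a ^ k) x)‖)
      hg1 hκ'0.le ((min_le_right _ _).trans hg1) (fun _ => norm_nonneg _) (fun k hk => hq k hk.le)
      (fun k hk => (hb k hk.le).trans (by gcongr)) ⟨k, hk, (min_le_left _ _).trans hkκ⟩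
    simpa using this
  intro x
  rcases eq_or_ne x 0 with rfl | hx
  · simp
  have hx' : 0 < ‖x‖ := norm_pos_iff.2 hx
  have h1 := hunit (‖x‖⁻¹ • x) (by rw [norm_smul, norm_inv, norm_norm, inv_mul_cancel₀ hx'.ne'])
  rw [map_smul, norm_smul, norm_inv, norm_norm] at h1
  rw [div_div, ← hg]
  calc _ ≤ ‖x‖⁻¹ * ‖W x‖ * ‖x‖ := by gcongr
    _ = _ := by field_simp

/-- For an observable pair `(D, A†)` the Riccati equation with arbitrarily fast decay has a
solution whose condition number is beaten by the decay over a time `τ`. -/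
lemma exists_riccati_solution [Nontrivial F] [FiniteDimensional ℝ F] (A : F →L[ℝ] F)
    (D : F →L[ℝ] G) (n : ℕ) {κ : ℝ} (hκ : 0 < κ)
    (hobs : ∀ x : F, ‖x‖ = 1 → ∃ k < n, κ ≤ ‖D ((adjoint A ^ k) x)‖) {τ ε : ℝ} (hτ : 0 < τ)
    (hε : 0 < ε) :
    ∃ (γ c₁ c₂ : ℝ) (S : F →L[ℝ] F), 0 ≤ γ ∧ 0 < c₁ ∧ 0 ≤ c₂ ∧
      (∀ x y, ⟪S x, y⟫ = ⟪x, S y⟫) ∧ (∀ z, c₁ * ‖z‖ ^ 2 ≤ ⟪S z, z⟫) ∧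
      (∀ z, ⟪S z, z⟫ ≤ c₂ * ‖z‖ ^ 2) ∧
      S * A + adjoint A * S = S * (adjoint D ∘L D) * S - (2 * γ) • S ∧
      c₂ * Real.exp (-2 * γ * τ) ≤ ε ^ 2 * c₁ := by
  obtain ⟨c, hc, hlow⟩ := exists_le_norm_lyapunov_solution A D n hκ hobs
  set q₀ := ‖adjoint D ∘L D‖ with hq₀
  obtain ⟨γ, hγ1, hγA, hγ⟩ : ∃ γ : ℝ, 1 ≤ γ ∧ ‖A‖ + 1 / 2 ≤ γ ∧
      ((c / γ ^ 2) ^ 2 ^ n)⁻¹ * Real.exp (-2 * γ * τ) ≤ ε ^ 2 * (q₀ + 1)⁻¹ := by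
    have h1 : Filter.Tendsto (fun γ : ℝ => 2 * τ * γ) Filter.atTop Filter.atTop :=
      Filter.tendsto_id.const_mul_atTop (by positivity)
    have h2 := ((Real.tendsto_pow_mul_exp_neg_atTop_nhds_zero (2 * 2 ^ n)).comp h1).const_mul
      ((c ^ 2 ^ n)⁻¹ * ((2 * τ) ^ (2 * 2 ^ n))⁻¹)
    rw [mul_zero] at h2
    have h3 : 0 < ε ^ 2 * (q₀ + 1)⁻¹ := by have := norm_nonneg (adjoint D ∘L D); positivity
    obtain ⟨γ, h4, h5, h6⟩ := ((h2.eventually_lt_const h3).and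
      ((Filter.eventually_ge_atTop 1).and (Filter.eventually_ge_atTop (‖A‖ + 1 / 2)))).exists
    refine ⟨γ, h5, h6, le_trans (le_of_eq ?_) h4.le⟩
    simp only [Function.comp]
    rw [mul_pow (2 * τ) γ, show -(2 * τ * γ) = -2 * γ * τ by ring, div_pow, ← pow_mul]
    have : (2 * τ) ^ (2 * 2 ^ n) ≠ 0 := by positivity
    field_simp
  have hγ0 : 0 < γ := by linarith
  obtain ⟨W, hW, hWn, hL⟩ := exists_lyapunov_solution A (adjoint D ∘L D)
    ((ContinuousLinearMap.isPositive_one (E := G) (𝕜 := ℝ)).adjoint_conj D) hγA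
  have hWl := hlow γ W hγ1 (by linarith) hW hWn hL
  set l := (c / γ ^ 2) ^ 2 ^ n with hl
  have hl0 : 0 < l := by positivity
  have hinj : Function.Injective W := by
    refine (injective_iff_map_eq_zero W).2 fun x hx => ?_
    have := hWl x
    rw [hx, norm_zero] at this
    exact norm_le_zero_iff.1 (by nlinarith [norm_nonneg x])
  let e := LinearEquiv.ofInjectiveEndo (W : F →ₗ[ℝ] F) hinj
  let S : F →L[ℝ] F := LinearMap.toContinuousLinearMap (e.symm : F →ₗ[ℝ] F)
  have hWS : ∀ x, W (S x) = x := fun x => e.apply_symm_apply x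
  have hSW : ∀ x, S (W x) = x := fun x => e.symm_apply_apply x
  have hSn : ∀ z, ‖S z‖ ≤ l⁻¹ * ‖z‖ := fun z => by
    have := hWl (S z)
    rw [hWS] at this
    rwa [le_inv_mul_iff₀ hl0]
  have hSs : ∀ x y, ⟪S x, y⟫ = ⟪x, S y⟫ := fun x y => by
    have := hW.isSymmetric (S x) (S y)
    simp only [ContinuousLinearMap.coe_coe, hWS] at this
    exact this.symm
  refine ⟨γ, (q₀ + 1)⁻¹, l⁻¹, S, hγ0.le, by have := norm_nonneg (adjoint D ∘L D); positivity,
    by positivity, hSs, fun z => ?_, fun z => ?_, ?_, hγ⟩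
  · have h1 := hW.norm_apply_sq_le (S z)
    have h2 := hW.inner_nonneg_left (S z)
    rw [hWS] at h1 h2
    rw [inv_mul_le_iff₀ (by have := norm_nonneg (adjoint D ∘L D); positivity), hSs]
    refine h1.trans ?_
    gcongr
    linarith
  · calc ⟪S z, z⟫ ≤ ‖S z‖ * ‖z‖ := real_inner_le_norm _ _
      _ ≤ l⁻¹ * ‖z‖ * ‖z‖ := by gcongr; exact hSn z
      _ = _ := by ring
  · have hWS' : W * S = 1 := ContinuousLinearMap.ext hWS
    have hSW' : S * W = 1 := ContinuousLinearMap.ext hSW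
    have h1 : S * ((A + γ • 1) * W + W * (adjoint A + γ • 1)) * S =
        S * (A + γ • 1) * (W * S) + (S * W) * (adjoint A + γ • 1) * S := by noncomm_ring
    rw [hL, hWS', hSW'] at h1
    rw [h1]
    simp only [mul_add, add_mul, mul_one, one_mul, mul_smul_comm, smul_mul_assoc, two_mul, add_smul]
    abel

end Gain

/-! ### Passage to matrices -/

section Matrices

open scoped RealInnerProductSpace
open ContinuousLinearMap (adjoint)

lemma Matrix.PosSemidef.inner_toEuclideanCLM_nonneg {ι : Type*} [Fintype ι] [DecidableEq ι]
    {X : Matrix ι ι ℝ} (hX : X.PosSemidef) (z : EuclideanSpace ℝ ι) :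
    0 ≤ ⟪toEuclideanCLM (𝕜 := ℝ) X z, z⟫ := by
  rw [real_inner_comm, Matrix.inner_toEuclideanCLM]
  exact hX.dotProduct_mulVec_nonneg z.ofLp

lemma Matrix.PosSemidef.of_toEuclideanCLM {ι : Type*} [Fintype ι] [DecidableEq ι]
    {X : Matrix ι ι ℝ} (hsymm : ∀ x y, ⟪toEuclideanCLM (𝕜 := ℝ) X x, y⟫ = ⟪x, toEuclideanCLM (𝕜 := ℝ) X y⟫)
    (hpos : ∀ z, 0 ≤ ⟪toEuclideanCLM (𝕜 := ℝ) X z, z⟫) : X.PosSemidef := by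
  rw [← Matrix.isPositive_toEuclideanLin_iff]
  exact ⟨hsymm, hpos⟩

lemma Matrix.toEuclideanCLM_transpose {ι : Type*} [Fintype ι] [DecidableEq ι] (X : Matrix ι ι ℝ) :
    toEuclideanCLM (𝕜 := ℝ) Xᵀ = adjoint (toEuclideanCLM (𝕜 := ℝ) X) := by
  rw [← ContinuousLinearMap.star_eq_adjoint, ← map_star, Matrix.star_eq_conjTranspose,
    Matrix.conjTranspose_eq_transpose_of_trivial]

/-- A controllable pair is observable through its transpose, uniformly on the unit sphere. -/
lemma exists_observability_bound {n m : ℕ} (A : Matrix (Fin n) (Fin n) ℝ)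
    (B : Matrix (Fin n) (Fin m) ℝ) (hctrb : (ctrbMatrix A B).rank = n)
    (D : EuclideanSpace ℝ (Fin n) →L[ℝ] EuclideanSpace ℝ (Fin m))
    (hD : ∀ x, (D x).ofLp = Bᵀ *ᵥ x.ofLp) :
    ∃ κ : ℝ, 0 < κ ∧ ∀ x : EuclideanSpace ℝ (Fin n), ‖x‖ = 1 →
      ∃ k < n, κ ≤ ‖D ((adjoint (toEuclideanCLM (𝕜 := ℝ) A) ^ k) x)‖ := by
  set a := adjoint (toEuclideanCLM (𝕜 := ℝ) A) with ha
  have hak : ∀ k x, ((a ^ k) x).ofLp = (A ^ k)ᵀ *ᵥ x.ofLp := fun k x => by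
    rw [ha, ← Matrix.toEuclideanCLM_transpose, ← map_pow, Matrix.ofLp_toEuclideanCLM,
      Matrix.transpose_pow]
  have hinj : ∀ v : Fin n → ℝ, (ctrbMatrix A B)ᵀ *ᵥ v = 0 → v = 0 := by
    have h1 : Module.finrank ℝ (LinearMap.range (ctrbMatrix A B)ᵀ.mulVecLin) = n := by
      rw [← Matrix.rank, Matrix.rank_transpose]; exact hctrb
    have h2 := (ctrbMatrix A B)ᵀ.mulVecLin.finrank_range_add_finrank_ker
    rw [h1, Module.finrank_fin_fun] at h2
    have h3 : LinearMap.ker (ctrbMatrix A B)ᵀ.mulVecLin = ⊥ := Submodule.finrank_eq_zero.1 (by omega)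
    intro v hv
    have : v ∈ LinearMap.ker (ctrbMatrix A B)ᵀ.mulVecLin := hv
    rwa [h3] at this
  let φ : EuclideanSpace ℝ (Fin n) → ℝ := fun x => ∑ k ∈ Finset.range n, ‖D ((a ^ k) x)‖
  have hφc : Continuous φ := by fun_prop
  rcases (Metric.sphere (0 : EuclideanSpace ℝ (Fin n)) 1).eq_empty_or_nonempty with he | hne
  · refine ⟨1, one_pos, fun x hx => ?_⟩
    have : x ∈ Metric.sphere (0 : EuclideanSpace ℝ (Fin n)) 1 := by simpa using hx
    simp [he] at this
  obtain ⟨x₀, hx₀, hmin⟩ := (isCompact_sphere (0 : EuclideanSpace ℝ (Fin n)) 1).exists_isMinOn hne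
    hφc.continuousOn
  have hx₀' : ‖x₀‖ = 1 := by simpa using hx₀
  have hφ0 : 0 < φ x₀ := by
    refine lt_of_le_of_ne (Finset.sum_nonneg fun _ _ => norm_nonneg _) fun h0 => ?_
    have h1 := (Finset.sum_eq_zero_iff_of_nonneg (fun _ _ => norm_nonneg _)).1 h0.symm
    have h2 : x₀.ofLp = 0 := by
      refine hinj _ (funext fun p => ?_)
      have h3 : (D ((a ^ (p.1 : ℕ)) x₀)).ofLp = 0 := by
        rw [norm_eq_zero.1 (h1 p.1 (Finset.mem_range.2 p.1.2))]; rfl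
      rw [hD, hak, Matrix.mulVec_mulVec, ← Matrix.transpose_mul] at h3
      exact congrFun h3 p.2
    have h3 : x₀ = 0 := by ext i; exact congrFun h2 i
    simp [h3] at hx₀'
  have hn : 0 < n := by
    rcases Nat.eq_zero_or_pos n with rfl | h
    · simp [φ] at hφ0
    · exact h
  refine ⟨φ x₀ / n, by positivity, fun x hx => ?_⟩
  by_contra! hcon
  have h1 : φ x < φ x₀ := by
    calc φ x < ∑ _k ∈ Finset.range n, φ x₀ / n :=
          Finset.sum_lt_sum_of_nonempty ⟨0, Finset.mem_range.2 hn⟩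
            fun k hk => hcon k (Finset.mem_range.1 hk)
      _ = φ x₀ := by simp; field_simp
  exact absurd (hmin (by simpa using hx : x ∈ Metric.sphere _ _)) (not_le.2 h1)

lemma exists_riccati_matrix {n m : ℕ} (hn : 1 ≤ n) (A : Matrix (Fin n) (Fin n) ℝ)
    (B : Matrix (Fin n) (Fin m) ℝ) (hctrb : (ctrbMatrix A B).rank = n) {τ ε : ℝ} (hτ : 0 < τ)
    (hε : 0 < ε) :
    ∃ (γ c₁ c₂ : ℝ) (S : Matrix (Fin n) (Fin n) ℝ), 0 ≤ γ ∧ 0 < c₁ ∧ 0 ≤ c₂ ∧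
      (S - c₁ • 1).PosSemidef ∧ (c₂ • 1 - S).PosSemidef ∧
      S * A + Aᵀ * S = S * (B * Bᵀ) * S - (2 * γ) • S ∧
      c₂ * Real.exp (-2 * γ * τ) ≤ ε ^ 2 * c₁ := by
  have : Nonempty (Fin n) := ⟨⟨0, hn⟩⟩
  let D : EuclideanSpace ℝ (Fin n) →L[ℝ] EuclideanSpace ℝ (Fin m) :=
    LinearMap.toContinuousLinearMap (Matrix.toLpLin 2 2 Bᵀ)
  have hD : ∀ x, (D x).ofLp = Bᵀ *ᵥ x.ofLp := fun x => rfl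
  obtain ⟨κ, hκ, hobs⟩ := exists_observability_bound A B hctrb D hD
  obtain ⟨γ, c₁, c₂, S, hγ, hc₁, hc₂, hS, hS₁, hS₂, hric, hcond⟩ :=
    exists_riccati_solution (toEuclideanCLM (𝕜 := ℝ) A) D n hκ hobs hτ hε
  let T := toEuclideanCLM (𝕜 := ℝ) (n := Fin n)
  have hTS : T (T.symm S) = S := T.apply_symm_apply S
  have hDD : adjoint D ∘L D = T (B * Bᵀ) := by
    refine ContinuousLinearMap.ext fun y => ext_inner_left ℝ fun x => ?_
    change ⟪x, adjoint D (D y)⟫ = _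
    rw [ContinuousLinearMap.adjoint_inner_right]
    change _ = ⟪x, toEuclideanCLM (𝕜 := ℝ) (B * Bᵀ) y⟫
    rw [Matrix.inner_toEuclideanCLM, EuclideanSpace.inner_eq_star_dotProduct, hD, hD, star_trivial,
      ← Matrix.mulVec_mulVec, Matrix.dotProduct_mulVec, ← Matrix.mulVec_transpose, dotProduct_comm,
      Matrix.transpose_transpose]
  refine ⟨γ, c₁, c₂, T.symm S, hγ, hc₁, hc₂, ?_, ?_, ?_, hcond⟩
  · have h1 : toEuclideanCLM (𝕜 := ℝ) (T.symm S - c₁ • 1) = S - c₁ • 1 := by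
      rw [map_sub, map_smul, map_one]; exact congrArg (· - c₁ • 1) hTS
    refine Matrix.PosSemidef.of_toEuclideanCLM (fun x y => ?_) fun z => ?_ <;> rw [h1]
    · simp [inner_sub_left, inner_sub_right, hS, inner_smul_left, inner_smul_right]
    · have := hS₁ z
      simpa [inner_sub_left, inner_smul_left] using this
  · have h1 : toEuclideanCLM (𝕜 := ℝ) (c₂ • 1 - T.symm S) = c₂ • 1 - S := by
      rw [map_sub, map_smul, map_one]; exact congrArg (c₂ • 1 - ·) hTS
    refine Matrix.PosSemidef.of_toEuclideanCLM (fun x y => ?_) fun z => ?_ <;> rw [h1]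
    · simp [inner_sub_left, inner_sub_right, hS, inner_smul_left, inner_smul_right]
    · have := hS₂ z
      simpa [inner_sub_left, inner_smul_left] using this
  · refine EquivLike.injective T ?_
    rw [hDD, ← Matrix.toEuclideanCLM_transpose] at hric
    rw [map_add, map_sub, map_mul, map_mul, map_mul, map_mul, map_smul, hTS]
    exact hric

/-- A positive semidefinite matrix has a spectral gap above its kernel. -/
lemma Matrix.PosSemidef.exists_gap {N : ℕ} {H : Matrix (Fin N) (Fin N) ℝ} (hH : H.PosSemidef) :
    ∃ l : ℝ, 0 < l ∧ ∀ P : Matrix (Fin N) (Fin N) ℝ, Pᵀ = P → P * P = P → H * P = 0 → P * H = 0 →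
      (∀ x, H *ᵥ x = 0 → P *ᵥ x = x) → ∀ c, 1 ≤ c * l → (c • H - 1 + P).PosSemidef := by
  set h := toEuclideanCLM (𝕜 := ℝ) H with hh
  have hpos : h.IsPositive := by
    rw [ContinuousLinearMap.isPositive_iff]
    have h1 := Matrix.isPositive_toEuclideanLin_iff.2 hH
    exact ⟨h1.1, hH.inner_toEuclideanCLM_nonneg⟩
  let K := LinearMap.ker (h : EuclideanSpace ℝ (Fin N) →ₗ[ℝ] EuclideanSpace ℝ (Fin N))
  have hker : LinearMap.ker ((h : EuclideanSpace ℝ (Fin N) →ₗ[ℝ] EuclideanSpace ℝ (Fin N)) ∘ₗ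
      Kᗮ.subtype) = ⊥ := by
    refine (LinearMap.ker_eq_bot').2 fun y hy => ?_
    have h1 : (y : EuclideanSpace ℝ (Fin N)) ∈ K := hy
    have h2 := K.inner_right_of_mem_orthogonal h1 y.2
    exact Subtype.ext (inner_self_eq_zero.1 h2)
  obtain ⟨c₀, hc₀, hanti⟩ := LinearMap.exists_antilipschitzWith _ hker
  have hlow : ∀ y ∈ Kᗮ, ‖y‖ ≤ c₀ * ‖h y‖ := fun y hy => by
    have := hanti.le_mul_norm_sub ⟨y, hy⟩ 0
    simpa using this
  refine ⟨(c₀ ^ 2 * (‖h‖ + 1))⁻¹, by positivity, fun P hPt hPP hHP hPH hfix c hc => ?_⟩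
  set p := toEuclideanCLM (𝕜 := ℝ) P with hp
  have hps : ∀ x y, ⟪p x, y⟫ = ⟪x, p y⟫ := fun x y => by
    have := ContinuousLinearMap.adjoint_inner_left p y x
    rwa [hp, ← Matrix.toEuclideanCLM_transpose, hPt] at this
  have hpp : ∀ x, p (p x) = p x := fun x => by
    have := congrArg (toEuclideanCLM (𝕜 := ℝ)) hPP
    rw [map_mul] at this
    exact congrArg (fun X : EuclideanSpace ℝ (Fin N) →L[ℝ] _ => X x) this
  have hhp : ∀ x, h (p x) = 0 := fun x => by
    have := congrArg (toEuclideanCLM (𝕜 := ℝ)) hHP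
    rw [map_mul, map_zero] at this
    exact congrArg (fun X : EuclideanSpace ℝ (Fin N) →L[ℝ] _ => X x) this
  have hph : ∀ x, p (h x) = 0 := fun x => by
    have := congrArg (toEuclideanCLM (𝕜 := ℝ)) hPH
    rw [map_mul, map_zero] at this
    exact congrArg (fun X : EuclideanSpace ℝ (Fin N) →L[ℝ] _ => X x) this
  have hX : toEuclideanCLM (𝕜 := ℝ) (c • H - 1 + P) = c • h - 1 + p := by
    rw [map_add, map_sub, map_smul, map_one]
  have hc0 : 0 < c := by
    by_contra hcon
    have : c * (c₀ ^ 2 * (‖h‖ + 1))⁻¹ ≤ 0 := mul_nonpos_of_nonpos_of_nonneg (not_lt.1 hcon)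
      (by positivity)
    linarith
  refine Matrix.PosSemidef.of_toEuclideanCLM (fun x y => ?_) fun z => ?_ <;> rw [hX]
  · have h1 : ⟪h x, y⟫ = ⟪x, h y⟫ := hpos.isSymmetric x y
    simp [inner_sub_left, inner_sub_right, inner_add_left, inner_add_right, inner_smul_left,
      inner_smul_right, hps, h1]
  · set y := z - p z with hy
    have hyK : y ∈ Kᗮ := by
      refine (Submodule.mem_orthogonal _ _).2 fun w hw => ?_
      have h1 : p w = w := by
        have h2 : H *ᵥ w.ofLp = 0 := by
          have h3 : h w = 0 := hw
          rw [← Matrix.ofLp_toEuclideanCLM (𝕜 := ℝ), ← hh, h3]; rfl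
        have := hfix _ h2
        rw [← Matrix.ofLp_toEuclideanCLM (𝕜 := ℝ)] at this
        exact WithLp.ofLp_injective 2 this
      rw [← h1, hps, hy, map_sub, hpp, sub_self, inner_zero_right]
    have h1 := hlow y hyK
    have h2 := hpos.norm_apply_sq_le y
    have h3 : ⟪h y, y⟫ = ⟪h z, z⟫ := by
      rw [hy, map_sub, hhp, sub_zero, inner_sub_right, ← hps, hph, inner_zero_left, sub_zero]
    have h4 : ⟪y, y⟫ = ⟪z, z⟫ - ⟪p z, z⟫ := by
      rw [hy, inner_sub_left, inner_sub_right, inner_sub_right, hps z (p z), hpp,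
        real_inner_comm (p z) z]
      ring
    have h5 := hpos.inner_nonneg_left y
    have h6 : ‖y‖ ^ 2 ≤ c * ⟪h y, y⟫ := by
      calc ‖y‖ ^ 2 ≤ (c₀ * ‖h y‖) ^ 2 := by gcongr
        _ = c₀ ^ 2 * ‖h y‖ ^ 2 := by ring
        _ ≤ c₀ ^ 2 * (‖h‖ * ⟪h y, y⟫) := by gcongr
        _ ≤ (c₀ ^ 2 * (‖h‖ + 1)) * ⟪h y, y⟫ := by
            rw [← mul_assoc]; gcongr; linarith
        _ ≤ c * ⟪h y, y⟫ := by
            gcongr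
            have : (c₀ : ℝ) ^ 2 * (‖h‖ + 1) > 0 := by positivity
            rwa [← div_eq_mul_inv, one_le_div this] at hc
    rw [← real_inner_self_eq_norm_sq, h4, h3] at h6
    simp only [_root_.add_apply, _root_.sub_apply, _root_.smul_apply,
      one_apply_eq_self, inner_add_left, inner_sub_left, inner_smul_left, conj_trivial]
    linarith

end Matrices

/-! ### Exponential decay of switched linear dynamics -/

section Decay

open scoped RealInnerProductSpace

lemma nat_mul_le_of_dwell {ts : ℕ → ℝ} {τ : ℝ} (hdwell : ∀ r, τ ≤ ts (r + 1) - ts r) {p q : ℕ}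
    (hpq : p ≤ q) : ((q - p : ℕ) : ℝ) * τ ≤ ts q - ts p := by
  obtain ⟨i, rfl⟩ := Nat.exists_eq_add_of_le hpq
  rw [Nat.add_sub_cancel_left]
  clear hpq
  induction i with
  | zero => simp
  | succ i ih =>
    have := hdwell (p + i)
    rw [add_assoc] at this
    push_cast
    linarith

lemma exists_mem_Ico_of_nat_mul_le {u : ℕ → ℝ} {τ : ℝ} (hτ : 0 < τ) (hu0 : u 0 = 0)
    (hu : ∀ k : ℕ, k * τ ≤ u k) {t : ℝ} (ht : 0 ≤ t) : ∃ k, t ∈ Set.Ico (u k) (u (k + 1)) := by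
  have hex : ∃ k, t < u k := by
    obtain ⟨k, hk⟩ := exists_nat_gt (t / τ)
    exact ⟨k, ((div_lt_iff₀ hτ).1 hk).trans_le (hu k)⟩
  classical
  have h1 := Nat.find_spec hex
  obtain ⟨k, hk⟩ : ∃ k, Nat.find hex = k + 1 := Nat.exists_eq_succ_of_ne_zero fun h0 => by
    rw [h0, hu0] at h1; linarith
  rw [hk] at h1
  exact ⟨k, not_lt.1 (Nat.find_min hex (by omega)), h1⟩

variable {E : Type*} [NormedAddCommGroup E] [InnerProductSpace ℝ E] [CompleteSpace E]

lemma norm_le_exp_of_switched {a : E →L[ℝ] E} {h P : ℕ → E →L[ℝ] E} {S : E →L[ℝ] E}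
    {α M γ c₁ c₂ τ ε Tc L' ρ : ℝ} {L : ℕ} (hα : 0 ≤ α) (hM1 : 1 ≤ M)
    (hM : ∀ t : ℝ, 0 ≤ t → ‖exp (t • a)‖ ≤ M * Real.exp (α * t))
    (hPa : ∀ r, Commute (P r) a) (hPh : ∀ r, P r * h r = 0) (hhP : ∀ r, h r * P r = 0)
    (hPP : ∀ r, P r * P r = P r) (hP1 : ∀ r, ‖P r‖ ≤ 1) (hP1' : ∀ r x, ‖x - P r x‖ ≤ ‖x‖)
    (hS : ∀ x y, ⟪S x, y⟫ = ⟪x, S y⟫) (hγ : 0 ≤ γ) (hc₁ : 0 < c₁) (hc₂ : 0 ≤ c₂) (hε : 0 ≤ ε)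
    (hε1 : ε ≤ 1)
    (hS₁ : ∀ z, c₁ * ‖z‖ ^ 2 ≤ ⟪S z, z⟫) (hS₂ : ∀ z, ⟪S z, z⟫ ≤ c₂ * ‖z‖ ^ 2)
    (hcond : c₂ * Real.exp (-2 * γ * τ) ≤ ε ^ 2 * c₁)
    (hdiss : ∀ r z, P r z = 0 → ⟪S z, (a - h r) z⟫ ≤ -γ * ⟪S z, z⟫)
    (hL' : ∀ r, ‖a - h r‖ ≤ L')
    (hτ : 0 < τ) {ts : ℕ → ℝ} (hts0 : ts 0 = 0) (hdwell : ∀ r : ℕ, τ ≤ ts (r + 1) - ts r)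
    {j : ℕ → ℕ} (hj0 : j 0 = 0) (hjmono : StrictMono j) (hTc : 0 < Tc)
    (hTcb : ∀ k : ℕ, ts (j (k + 1)) - ts (j k) ≤ Tc) (hL : Tc ≤ L * τ)
    (hρ0 : 0 < ρ) (hρ1 : ρ < 1)
    (hρ : ∀ k, ‖descProd P (j k) (j (k + 1))‖ * Real.exp (α * Tc) +
      ε * (L * M * (Real.exp (α * Tc) + M) ^ L) ≤ ρ)
    {x : ℝ → E}
    (hx : ∀ r : ℕ, ∀ s ∈ Set.Ico (ts r) (ts (r + 1)),
      HasDerivWithinAt x ((a - h r) (x s)) (Set.Ici (0 : ℝ)) s) {t : ℝ} (ht : 0 ≤ t) :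
    ‖x t‖ ≤ Real.exp (L' * Tc) * M / ρ * Real.exp (-(-Real.log ρ / Tc) * t) * ‖x 0‖ := by
  have htsm : Monotone ts := monotone_nat_of_le_succ fun r => by linarith [hdwell r]
  have hts : ∀ r : ℕ, r * τ ≤ ts r := fun r => by
    simpa [hts0] using nat_mul_le_of_dwell hdwell (Nat.zero_le r)
  have hts_nonneg : ∀ r, 0 ≤ ts r := fun r => le_trans (by positivity) (hts r)
  have hex : ∀ s : ℝ, 0 ≤ s → ∃ r, HasDerivWithinAt x ((a - h r) (x s)) (Set.Ici (0 : ℝ)) s :=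
    fun s hs => by
      obtain ⟨r, hr⟩ := exists_mem_Ico_of_nat_mul_le hτ hts0 hts hs
      exact ⟨r, hx r s hr⟩
  have hcont : ContinuousOn x (Set.Ici 0) := fun s hs => by
    obtain ⟨r, hr⟩ := hex s hs
    exact hr.continuousWithinAt
  have hIcc : ∀ {u v : ℝ}, 0 ≤ u → ContinuousOn x (Set.Icc u v) := fun hu =>
    hcont.mono fun s hs => hu.trans hs.1
  have hIci : ∀ {s : ℝ}, 0 ≤ s → Set.Ici s ⊆ Set.Ici (0 : ℝ) := fun hs => Set.Ici_subset_Ici.2 hs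
  obtain ⟨ν, hadd, hν₁, hν₂, hν⟩ := exists_adapted_gauge a hM
  have hstep : ∀ r, ‖x (ts (r + 1)) - exp ((ts (r + 1) - ts r) • a) (P r (x (ts r)))‖ ≤
      ε * ‖x (ts r)‖ := fun r =>
    norm_sub_exp_apply_le_of_hasDerivWithinAt (hPa r) (hPh r) (hhP r) (hPP r) (hP1' r) hS hγ hc₁ hc₂
      hε hS₁ hS₂ hcond (hdiss r) (htsm r.le_succ) (hdwell r) (hIcc (hts_nonneg r))
      fun s hs => (hx r s hs).mono (hIci ((hts_nonneg r).trans hs.1))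
  have hjle : ∀ k, j k ≤ j (k + 1) := fun k => (hjmono k.lt_succ_self).le
  have hlen : ∀ k, j (k + 1) - j k ≤ L := fun k => by
    have h1 := nat_mul_le_of_dwell hdwell (hjle k)
    have h2 : ((j (k + 1) - j k : ℕ) : ℝ) * τ ≤ L * τ := h1.trans ((hTcb k).trans hL)
    exact_mod_cast le_of_mul_le_mul_right h2 hτ
  have hν0 : ∀ y, 0 ≤ ν y := fun y => (norm_nonneg y).trans (hν₁ y)
  have hblock : ∀ k, ν (x (ts (j k))) ≤ ρ ^ k * ν (x 0) := by
    intro k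
    induction k with
    | zero => simp [hj0, hts0]
    | succ k ih =>
      have := gauge_le_of_block (X := fun r => x (ts r)) hα hM1 hε hε1 hadd hν₁ hν₂ hν hPa hP1 htsm
        hstep (hjle k) (hlen k) (hTcb k)
      calc _ ≤ ρ * ν (x (ts (j k))) :=
            this.trans (mul_le_mul_of_nonneg_right (hρ k) (hν0 _))
        _ ≤ ρ * (ρ ^ k * ν (x 0)) := by gcongr
        _ = _ := by ring
  obtain ⟨k, hk⟩ := exists_mem_Ico_of_nat_mul_le (u := fun k => ts (j k)) hτ (by simp [hj0, hts0])
    (fun k => (hts k).trans (htsm (hjmono.id_le k))) ht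
  have hu0 := hts_nonneg (j k)
  have hgron : ‖x t‖ ≤ Real.exp (L' * Tc) * ‖x (ts (j k))‖ := by
    choose! r hr using hex
    have h1 := norm_le_gronwallBound_of_norm_deriv_right_le (f := x)
      (f' := fun s => (a - h (r s)) (x s)) (δ := ‖x (ts (j k))‖) (K := L') (ε := 0)
      (a := ts (j k)) (b := t) (hIcc hu0)
      (fun s hs => (hr s (hu0.trans hs.1)).mono (hIci (hu0.trans hs.1))) le_rfl
      (fun s _ => by
        rw [add_zero]
        exact ((a - h (r s)).le_opNorm _).trans (by gcongr; exact hL' _)) t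
      (Set.right_mem_Icc.2 hk.1)
    rw [gronwallBound_ε0] at h1
    refine h1.trans ?_
    rw [mul_comm]
    have hL'0 : 0 ≤ L' := (norm_nonneg _).trans (hL' 0)
    have := hTcb k
    gcongr
    linarith [hk.2]
  have htk : t ≤ (k + 1) * Tc := by
    have h1 : ∀ k : ℕ, ts (j k) ≤ k * Tc := fun k => by
      induction k with
      | zero => simp [hj0, hts0]
      | succ k ih => push_cast; linarith [hTcb k]
    exact_mod_cast hk.2.le.trans (h1 (k + 1))
  have hlog : Real.log ρ < 0 := Real.log_neg hρ0 hρ1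
  have hexp : ρ ^ (k + 1) ≤ Real.exp (-(-Real.log ρ / Tc) * t) := by
    calc ρ ^ (k + 1) = Real.exp (Real.log ρ * (k + 1)) := by
          rw [Real.exp_mul, Real.exp_log hρ0]; exact_mod_cast (Real.rpow_natCast ρ (k + 1)).symm
      _ ≤ _ := by
          apply Real.exp_le_exp.2
          have h1 : Real.log ρ / Tc ≤ 0 := (div_neg_of_neg_of_pos hlog hTc).le
          calc Real.log ρ * (k + 1) = Real.log ρ / Tc * ((k + 1) * Tc) := by field_simp
            _ ≤ Real.log ρ / Tc * t := mul_le_mul_of_nonpos_left htk h1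
            _ = _ := by ring
  calc ‖x t‖ ≤ Real.exp (L' * Tc) * (ρ ^ k * (M * ‖x 0‖)) := by
        refine hgron.trans ?_
        gcongr
        exact (hν₁ _).trans ((hblock k).trans (by gcongr; exact hν₂ _))
    _ = Real.exp (L' * Tc) * M / ρ * ρ ^ (k + 1) * ‖x 0‖ := by field_simp; ring
    _ ≤ _ := by gcongr

end Decay

/-! ### Kronecker products with the identity -/

section Kron

open scoped RealInnerProductSpace

lemma sub_kronecker_eq {ι κ : Type*} (X Y : Matrix ι ι ℝ) (Z : Matrix κ κ ℝ) :
    (X - Y) ⊗ₖ Z = X ⊗ₖ Z - Y ⊗ₖ Z := by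
  ext
  simp [sub_mul]

/-- `X ↦ 1 ⊗ X` as an algebra homomorphism into the operators on Euclidean space. -/
noncomputable def oneKroneckerCLM (ι κ : Type*) [Fintype ι] [DecidableEq ι] [Fintype κ]
    [DecidableEq κ] :
    Matrix κ κ ℝ →ₐ[ℝ] (EuclideanSpace ℝ (ι × κ) →L[ℝ] EuclideanSpace ℝ (ι × κ)) :=
  AlgHom.ofLinearMap
    { toFun := fun X => toEuclideanCLM (𝕜 := ℝ) ((1 : Matrix ι ι ℝ) ⊗ₖ X)
      map_add' := fun X Y => by rw [Matrix.kronecker_add, map_add]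
      map_smul' := fun c X => by rw [Matrix.kronecker_smul, map_smul]; rfl }
    (by simp)
    (fun X Y => by
      simp only [LinearMap.coe_mk, AddHom.coe_mk]
      rw [← map_mul, ← Matrix.mul_kronecker_mul, one_mul])

/-- `X ↦ X ⊗ 1` as a monoid homomorphism into the operators on Euclidean space. -/
noncomputable def kroneckerOneCLM (ι κ : Type*) [Fintype ι] [DecidableEq ι] [Fintype κ]
    [DecidableEq κ] :
    Matrix ι ι ℝ →* (EuclideanSpace ℝ (ι × κ) →L[ℝ] EuclideanSpace ℝ (ι × κ)) where
  toFun X := toEuclideanCLM (𝕜 := ℝ) (X ⊗ₖ (1 : Matrix κ κ ℝ))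
  map_one' := by simp
  map_mul' X Y := by rw [← map_mul, ← Matrix.mul_kronecker_mul, one_mul]

variable {ι κ : Type*} [Fintype ι] [DecidableEq ι] [Fintype κ] [DecidableEq κ]

lemma norm_toEuclideanCLM_apply_sq (X : Matrix ι ι ℝ) (z : EuclideanSpace ℝ ι) :
    ‖toEuclideanCLM (𝕜 := ℝ) X z‖ ^ 2 = ⟪toEuclideanCLM (𝕜 := ℝ) (Xᵀ * X) z, z⟫ := by
  rw [map_mul, Matrix.toEuclideanCLM_transpose, ← real_inner_self_eq_norm_sq]
  exact (ContinuousLinearMap.adjoint_inner_left _ _ _).symm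

lemma norm_kroneckerOneCLM_le (X : Matrix ι ι ℝ) : ‖kroneckerOneCLM ι κ X‖ ≤ opNorm X := by
  have hc : 0 ≤ opNorm X := norm_nonneg _
  have h1 : (opNorm X ^ 2 • (1 : Matrix ι ι ℝ) - Xᵀ * X).PosSemidef := by
    have h2 : toEuclideanCLM (𝕜 := ℝ) (opNorm X ^ 2 • (1 : Matrix ι ι ℝ) - Xᵀ * X) =
        opNorm X ^ 2 • 1 - toEuclideanCLM (𝕜 := ℝ) (Xᵀ * X) := by
      rw [map_sub, map_smul, map_one]
    refine Matrix.PosSemidef.of_toEuclideanCLM (fun x y => ?_) fun z => ?_ <;> rw [h2]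
    · have h3 : ⟪toEuclideanCLM (𝕜 := ℝ) (Xᵀ * X) x, y⟫ = ⟪x, toEuclideanCLM (𝕜 := ℝ) (Xᵀ * X) y⟫ := by
        rw [← ContinuousLinearMap.adjoint_inner_left, ← Matrix.toEuclideanCLM_transpose,
          Matrix.transpose_mul, Matrix.transpose_transpose]
      simp only [_root_.sub_apply, _root_.smul_apply, one_apply_eq_self, inner_sub_left,
        inner_sub_right, inner_smul_left, inner_smul_right, conj_trivial, h3]
    · have h3 : ‖toEuclideanCLM (𝕜 := ℝ) X z‖ ^ 2 ≤ (opNorm X * ‖z‖) ^ 2 := by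
        gcongr
        exact ContinuousLinearMap.le_opNorm _ _
      rw [norm_toEuclideanCLM_apply_sq, mul_pow] at h3
      simpa only [_root_.sub_apply, _root_.smul_apply, one_apply_eq_self, inner_sub_left,
        inner_smul_left, conj_trivial, real_inner_self_eq_norm_sq, sub_nonneg] using h3
  refine ContinuousLinearMap.opNorm_le_bound _ hc fun z => ?_
  refine abs_le_of_sq_le_sq' ?_ (by positivity) |>.2
  have h2 := (h1.kronecker (Matrix.PosSemidef.one (n := κ) (R := ℝ))).inner_toEuclideanCLM_nonneg z
  change ‖toEuclideanCLM (𝕜 := ℝ) (X ⊗ₖ (1 : Matrix κ κ ℝ)) z‖ ^ 2 ≤ _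
  rw [norm_toEuclideanCLM_apply_sq, ← Matrix.kroneckerMap_transpose, ← Matrix.mul_kronecker_mul,
    Matrix.transpose_one, one_mul, mul_pow]
  rw [sub_kronecker_eq, Matrix.smul_kronecker, Matrix.one_kronecker_one, map_sub, map_smul,
    map_one] at h2
  simpa only [_root_.sub_apply, _root_.smul_apply, one_apply_eq_self, inner_sub_left,
    inner_smul_left, conj_trivial, real_inner_self_eq_norm_sq, sub_nonneg] using h2

section Projection

variable {E : Type*} [NormedAddCommGroup E] [InnerProductSpace ℝ E] {p : E →L[ℝ] E}

lemma norm_apply_sq_of_symm_of_idem (hs : ∀ x y, ⟪p x, y⟫ = ⟪x, p y⟫) (hpp : p * p = p) (x : E) :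
    ‖p x‖ ^ 2 = ⟪p x, x⟫ := by
  have h1 : p (p x) = p x := congrArg (fun X : E →L[ℝ] E => X x) hpp
  rw [← real_inner_self_eq_norm_sq, ← hs, h1]

lemma norm_sub_apply_le_of_symm_of_idem (hs : ∀ x y, ⟪p x, y⟫ = ⟪x, p y⟫) (hpp : p * p = p)
    (x : E) : ‖x - p x‖ ≤ ‖x‖ := by
  have h1 := norm_apply_sq_of_symm_of_idem hs hpp x
  have h2 := norm_sub_sq_real x (p x)
  rw [real_inner_comm, ← h1] at h2
  refine abs_le_of_sq_le_sq' ?_ (norm_nonneg _) |>.2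
  nlinarith [sq_nonneg ‖p x‖]

lemma norm_le_one_of_symm_of_idem (hs : ∀ x y, ⟪p x, y⟫ = ⟪x, p y⟫) (hpp : p * p = p) :
    ‖p‖ ≤ 1 := by
  refine ContinuousLinearMap.opNorm_le_bound _ zero_le_one fun x => ?_
  rw [one_mul]
  have h1 := norm_apply_sq_of_symm_of_idem hs hpp x
  have h2 := real_inner_le_norm (p x) x
  by_contra! hcon
  nlinarith [norm_nonneg x]

lemma norm_descProd_le_one {P : ℕ → E →L[ℝ] E} (hP : ∀ r, ‖P r‖ ≤ 1) {a b : ℕ} (hab : a ≤ b) :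
    ‖descProd P a b‖ ≤ 1 := by
  induction b, hab using Nat.le_induction with
  | base => rw [descProd_self]; exact ContinuousLinearMap.norm_id_le
  | succ b hb ih =>
    rw [descProd_succ P hb]
    exact (norm_mul_le _ _).trans (mul_le_one₀ (hP b) (norm_nonneg _) ih)

end Projection

lemma oneKroneckerCLM_apply (X : Matrix κ κ ℝ) :
    oneKroneckerCLM ι κ X = toEuclideanCLM (𝕜 := ℝ) ((1 : Matrix ι ι ℝ) ⊗ₖ X) := rfl

lemma adjoint_oneKroneckerCLM (X : Matrix κ κ ℝ) :
    ContinuousLinearMap.adjoint (oneKroneckerCLM ι κ X) = oneKroneckerCLM ι κ Xᵀ := by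
  rw [oneKroneckerCLM_apply, oneKroneckerCLM_apply, ← Matrix.toEuclideanCLM_transpose,
    ← Matrix.kroneckerMap_transpose, Matrix.transpose_one]

lemma inner_oneKroneckerCLM_left (X : Matrix κ κ ℝ) (x y : EuclideanSpace ℝ (ι × κ)) :
    ⟪oneKroneckerCLM ι κ X x, y⟫ = ⟪x, oneKroneckerCLM ι κ Xᵀ y⟫ := by
  rw [← adjoint_oneKroneckerCLM, ContinuousLinearMap.adjoint_inner_right]

lemma inner_oneKroneckerCLM_riccati {A S Q : Matrix κ κ ℝ} {γ : ℝ} (hSt : Sᵀ = S)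
    (hric : S * A + Aᵀ * S = Q - (2 * γ) • S) (z : EuclideanSpace ℝ (ι × κ)) :
    2 * ⟪oneKroneckerCLM ι κ S z, oneKroneckerCLM ι κ A z⟫ =
      ⟪oneKroneckerCLM ι κ Q z, z⟫ - 2 * γ * ⟪oneKroneckerCLM ι κ S z, z⟫ := by
  have h1 : ⟪oneKroneckerCLM ι κ (S * A + Aᵀ * S) z, z⟫ =
      2 * ⟪oneKroneckerCLM ι κ S z, oneKroneckerCLM ι κ A z⟫ := by
    rw [map_add, map_mul, map_mul, _root_.add_apply, inner_add_left,
      mul_apply_eq_comp, mul_apply_eq_comp, inner_oneKroneckerCLM_left,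
      inner_oneKroneckerCLM_left Aᵀ, Matrix.transpose_transpose, hSt, real_inner_comm]
    ring
  rw [← h1, hric, map_sub, map_smul, _root_.sub_apply, _root_.smul_apply, inner_sub_left,
    inner_smul_left, conj_trivial]

/-- The Riccati feedback dissipates the `S`-energy at rate `γ` off the kernel of `H`. -/
lemma riccati_dissipation {n m : ℕ} {A S : Matrix (Fin n) (Fin n) ℝ}
    {B : Matrix (Fin n) (Fin m) ℝ} {γ c : ℝ} (hSt : Sᵀ = S)
    (hric : S * A + Aᵀ * S = S * (B * Bᵀ) * S - (2 * γ) • S) {H P : Matrix ι ι ℝ}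
    (hgap : ((2 * c) • H - 1 + P).PosSemidef) {z : EuclideanSpace ℝ (ι × Fin n)}
    (hz : kroneckerOneCLM ι (Fin n) P z = 0) :
    ⟪oneKroneckerCLM ι (Fin n) S z,
      (oneKroneckerCLM ι (Fin n) A - toEuclideanCLM (𝕜 := ℝ) (H ⊗ₖ (B * (c • (Bᵀ * S))))) z⟫ ≤
      -γ * ⟪oneKroneckerCLM ι (Fin n) S z, z⟫ := by
  set Q := S * (B * Bᵀ) * S with hQ
  set f := oneKroneckerCLM ι (Fin n)
  have hf : ∀ X, f X = toEuclideanCLM (𝕜 := ℝ) ((1 : Matrix ι ι ℝ) ⊗ₖ X) := fun _ => rfl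
  have hQpos : Q.PosSemidef := by
    have := Matrix.posSemidef_self_mul_conjTranspose (S * B)
    rw [Matrix.conjTranspose_eq_transpose_of_trivial, Matrix.transpose_mul, hSt] at this
    convert this using 1
    simp only [hQ, Matrix.mul_assoc]
  have h1 := (hgap.kronecker hQpos).inner_toEuclideanCLM_nonneg z
  have hPQ : toEuclideanCLM (𝕜 := ℝ) (P ⊗ₖ Q) z = 0 := by
    have h2 : P ⊗ₖ Q = ((1 : Matrix ι ι ℝ) ⊗ₖ Q) * (P ⊗ₖ (1 : Matrix (Fin n) (Fin n) ℝ)) := by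
      rw [← Matrix.mul_kronecker_mul, one_mul, mul_one]
    rw [h2, map_mul]
    change toEuclideanCLM (𝕜 := ℝ) ((1 : Matrix ι ι ℝ) ⊗ₖ Q) (kroneckerOneCLM ι (Fin n) P z) = 0
    rw [hz, map_zero]
  rw [Matrix.add_kronecker, sub_kronecker_eq, Matrix.smul_kronecker, map_add, map_sub, map_smul,
    _root_.add_apply, hPQ, add_zero, _root_.sub_apply, _root_.smul_apply, inner_sub_left,
    inner_smul_left, conj_trivial, ← hf] at h1
  have hfS : ∀ x y, ⟪f S x, y⟫ = ⟪x, f S y⟫ := fun x y => by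
    rw [inner_oneKroneckerCLM_left, hSt]
  have hA := inner_oneKroneckerCLM_riccati hSt hric z
  have hH : ⟪f S z, toEuclideanCLM (𝕜 := ℝ) (H ⊗ₖ (B * (c • (Bᵀ * S)))) z⟫ =
      c * ⟪toEuclideanCLM (𝕜 := ℝ) (H ⊗ₖ Q) z, z⟫ := by
    have h2 : (H ⊗ₖ Q) = ((1 : Matrix ι ι ℝ) ⊗ₖ S) * (H ⊗ₖ (B * (Bᵀ * S))) := by
      rw [← Matrix.mul_kronecker_mul, one_mul, hQ]
      simp only [Matrix.mul_assoc]
    rw [Matrix.mul_smul, Matrix.kronecker_smul, map_smul, _root_.smul_apply, inner_smul_right, h2,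
      map_mul, hfS, real_inner_comm z]
    rfl
  rw [_root_.sub_apply, inner_sub_right, hH]
  linarith

end Kron

lemma posSemidef_lapMatrix_add_diagonal {N : ℕ} (G : SimpleGraph (Fin N)) [DecidableRel G.Adj]
    {d : Fin N → ℝ} (hd : ∀ i, 0 ≤ d i) : (G.lapMatrix ℝ + Matrix.diagonal d).PosSemidef :=
  (G.posSemidef_lapMatrix ℝ).add (Matrix.PosSemidef.diagonal hd)

lemma exists_tolerance {d K : ℝ} (hd : d < 1) (hK : 0 ≤ K) :
    ∃ ε : ℝ, 0 < ε ∧ ε ≤ 1 ∧ d + ε * K < 1 := by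
  have h1 : 0 < 1 - d := by linarith
  refine ⟨min 1 ((1 - d) / (K + 1)), by positivity, min_le_left _ _, ?_⟩
  have h2 : min 1 ((1 - d) / (K + 1)) * (K + 1) ≤ 1 - d :=
    (le_div_iff₀ (by positivity)).1 (min_le_right _ _)
  have h3 : 0 < min 1 ((1 - d) / (K + 1)) := by positivity
  linarith

lemma eNorm_eq_norm_toLp {ι : Type*} [Fintype ι] (v : ι → ℝ) : eNorm v = ‖WithLp.toLp 2 v‖ := by
  simp [eNorm, EuclideanSpace.norm_eq]

lemma HasDerivWithinAt.toLp_mulVec {ι : Type*} [Fintype ι] [DecidableEq ι] {X : Matrix ι ι ℝ}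
    {x : ℝ → ι → ℝ} {s : Set ℝ} {t : ℝ} (h : HasDerivWithinAt x (X *ᵥ x t) s t) :
    HasDerivWithinAt (fun u => WithLp.toLp 2 (x u))
      (toEuclideanCLM (𝕜 := ℝ) X (WithLp.toLp 2 (x t))) s t := by
  rw [Matrix.toEuclideanCLM_toLp]
  exact (PiLp.continuousLinearEquiv 2 ℝ fun _ : ι => ℝ).symm.hasFDerivAt.comp_hasDerivWithinAt t h

/-- A symmetric idempotent whose range lies in the kernel of a symmetric matrix is annihilated by
that matrix from both sides. -/
lemma mul_eq_zero_of_mulVec_mulVec {ι : Type*} [Fintype ι] [DecidableEq ι] {H P : Matrix ι ι ℝ}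
    (hH : Hᵀ = H) (hP : Pᵀ = P) (h : ∀ x, H *ᵥ (P *ᵥ x) = 0) : H * P = 0 ∧ P * H = 0 := by
  have h1 : H * P = 0 := Matrix.ext_of_mulVec_single fun i => by
    rw [← Matrix.mulVec_mulVec, h, Matrix.zero_mulVec]
  refine ⟨h1, ?_⟩
  have h2 := congrArg Matrix.transpose h1
  rwa [Matrix.transpose_mul, hH, hP, Matrix.transpose_zero] at h2

section Kron

open scoped RealInnerProductSpace

variable {ι κ : Type*} [Fintype ι] [DecidableEq ι] [Fintype κ] [DecidableEq κ]

lemma inner_toEuclideanCLM_of_symm {X : Matrix ι ι ℝ} (hX : Xᵀ = X) (x y : EuclideanSpace ℝ ι) :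
    ⟪toEuclideanCLM (𝕜 := ℝ) X x, y⟫ = ⟪x, toEuclideanCLM (𝕜 := ℝ) X y⟫ := by
  rw [← ContinuousLinearMap.adjoint_inner_left, ← Matrix.toEuclideanCLM_transpose, hX]

lemma inner_kroneckerOneCLM_of_symm {X : Matrix ι ι ℝ} (hX : Xᵀ = X)
    (x y : EuclideanSpace ℝ (ι × κ)) :
    ⟪kroneckerOneCLM ι κ X x, y⟫ = ⟪x, kroneckerOneCLM ι κ X y⟫ :=
  inner_toEuclideanCLM_of_symm
    (by rw [← Matrix.kroneckerMap_transpose, Matrix.transpose_one, hX]) x y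

lemma opNorm_descProd_le_one {P : ℕ → Matrix ι ι ℝ} (hs : ∀ r, (P r)ᵀ = P r)
    (hi : ∀ r, P r * P r = P r) {a b : ℕ} (hab : a ≤ b) : opNorm (descProd P a b) ≤ 1 := by
  change ‖MonoidHomClass.toMonoidHom (toEuclideanCLM (𝕜 := ℝ) (n := ι)) (descProd P a b)‖ ≤ 1
  rw [map_descProd]
  exact norm_descProd_le_one (fun r => norm_le_one_of_symm_of_idem
    (inner_toEuclideanCLM_of_symm (hs r)) (by
      change toEuclideanCLM (𝕜 := ℝ) (P r) * toEuclideanCLM (𝕜 := ℝ) (P r) = _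
      rw [← map_mul, hi])) hab

lemma commute_kroneckerOneCLM_oneKroneckerCLM (X : Matrix ι ι ℝ) (Y : Matrix κ κ ℝ) :
    Commute (kroneckerOneCLM ι κ X) (oneKroneckerCLM ι κ Y) := by
  change toEuclideanCLM (𝕜 := ℝ) _ * toEuclideanCLM (𝕜 := ℝ) _ =
    toEuclideanCLM (𝕜 := ℝ) _ * toEuclideanCLM (𝕜 := ℝ) _
  rw [← map_mul, ← map_mul, ← Matrix.mul_kronecker_mul, ← Matrix.mul_kronecker_mul, one_mul,
    mul_one, one_mul, mul_one]

lemma kroneckerOneCLM_mul_eq_zero {X Y : Matrix ι ι ℝ} (h : X * Y = 0) (Z : Matrix κ κ ℝ) :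
    kroneckerOneCLM ι κ X * toEuclideanCLM (𝕜 := ℝ) (Y ⊗ₖ Z) = 0 := by
  change toEuclideanCLM (𝕜 := ℝ) _ * _ = _
  rw [← map_mul, ← Matrix.mul_kronecker_mul, h, Matrix.zero_kronecker, map_zero]

lemma mul_kroneckerOneCLM_eq_zero {X Y : Matrix ι ι ℝ} (h : Y * X = 0) (Z : Matrix κ κ ℝ) :
    toEuclideanCLM (𝕜 := ℝ) (Y ⊗ₖ Z) * kroneckerOneCLM ι κ X = 0 := by
  change _ * toEuclideanCLM (𝕜 := ℝ) _ = _
  rw [← map_mul, ← Matrix.mul_kronecker_mul, h, Matrix.zero_kronecker, map_zero]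

lemma le_inner_oneKroneckerCLM {S : Matrix κ κ ℝ} {c : ℝ}
    (h : (S - c • (1 : Matrix κ κ ℝ)).PosSemidef) (z : EuclideanSpace ℝ (ι × κ)) :
    c * ‖z‖ ^ 2 ≤ ⟪oneKroneckerCLM ι κ S z, z⟫ := by
  have h1 : 0 ≤ ⟪oneKroneckerCLM ι κ (S - c • (1 : Matrix κ κ ℝ)) z, z⟫ :=
    ((Matrix.PosSemidef.one (n := ι) (R := ℝ)).kronecker h).inner_toEuclideanCLM_nonneg z
  rwa [map_sub, map_smul, map_one, _root_.sub_apply, _root_.smul_apply, one_apply_eq_self,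
    inner_sub_left, inner_smul_left, conj_trivial, real_inner_self_eq_norm_sq, sub_nonneg] at h1

lemma inner_oneKroneckerCLM_le {S : Matrix κ κ ℝ} {c : ℝ}
    (h : (c • (1 : Matrix κ κ ℝ) - S).PosSemidef) (z : EuclideanSpace ℝ (ι × κ)) :
    ⟪oneKroneckerCLM ι κ S z, z⟫ ≤ c * ‖z‖ ^ 2 := by
  have h1 : 0 ≤ ⟪oneKroneckerCLM ι κ (c • (1 : Matrix κ κ ℝ) - S) z, z⟫ :=
    ((Matrix.PosSemidef.one (n := ι) (R := ℝ)).kronecker h).inner_toEuclideanCLM_nonneg z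
  rwa [map_sub, map_smul, map_one, _root_.sub_apply, _root_.smul_apply, one_apply_eq_self,
    inner_sub_left, inner_smul_left, conj_trivial, real_inner_self_eq_norm_sq, sub_nonneg] at h1

end Kron

/-- One coupling strength works for all the graphs of a finite family. -/
lemma exists_coupling {N nP : ℕ} {Hmat : Fin nP → Matrix (Fin N) (Fin N) ℝ}
    (hH : ∀ p, (Hmat p).PosSemidef) : ∃ c : ℝ, ∀ p P, Pᵀ = P → P * P = P → Hmat p * P = 0 →
      P * Hmat p = 0 → (∀ x, Hmat p *ᵥ x = 0 → P *ᵥ x = x) →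
      ((2 * c) • Hmat p - 1 + P).PosSemidef := by
  choose l hl hgap using fun p => (hH p).exists_gap
  refine ⟨∑ p, (l p)⁻¹, fun p P h1 h2 h3 h4 h5 => hgap p P h1 h2 h3 h4 h5 _ ?_⟩
  have h6 : (l p)⁻¹ ≤ ∑ p, (l p)⁻¹ :=
    Finset.single_le_sum (fun q _ => (inv_pos.2 (hl q)).le) (Finset.mem_univ p)
  have h7 : (l p)⁻¹ * l p = 1 := inv_mul_cancel₀ (hl p).ne'
  nlinarith [mul_le_mul_of_nonneg_right h6 (hl p).le]

/-- leader-following exponential consensus over jointly connected switching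
networks: under the switching setup, controllability of `(A,B)`, and
`Re(μ) < -(ln δ)/T_c` for every complex eigenvalue `μ` of `A`, there exist a gain `K` and
constants `C, ϱ > 0` such that every differentiable solution of the switched error system
`x̄' = (I_N ⊗ A - H_{σ(j)} ⊗ BK) x̄` satisfies `‖x̄(t)‖ ≤ C e^{-ϱt} ‖x̄(0)‖`. -/
theorem leader_following_exponential_consensus
    (N n m nP : ℕ) (hN : 1 ≤ N) (hn : 1 ≤ n) (hm : 1 ≤ m)
    (G : Fin nP → SimpleGraph (Fin N)) [∀ p, DecidableRel (G p).Adj]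
    (Δ : Fin nP → (Fin N → ℝ)) (hΔ : ∀ p i, Δ p i = 0 ∨ Δ p i = 1)
    (Hmat : Fin nP → Matrix (Fin N) (Fin N) ℝ)
    (hHmat : ∀ p, Hmat p = (G p).lapMatrix ℝ + Matrix.diagonal (Δ p))
    (τ : ℝ) (hτ : 0 < τ)
    (ts : ℕ → ℝ) (hts0 : ts 0 = 0) (hdwell : ∀ r : ℕ, τ ≤ ts (r + 1) - ts r)
    (σ : ℕ → Fin nP)
    (j : ℕ → ℕ) (hj0 : j 0 = 0) (hjmono : StrictMono j)
    (Tc : ℝ) (hTc : 0 < Tc) (hTcb : ∀ k : ℕ, ts (j (k + 1)) - ts (j k) ≤ Tc)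
    (hjoint : ∀ k : ℕ, (∑ r ∈ Finset.Ico (j k) (j (k + 1)), Hmat (σ r)).PosDef)
    (Pproj : ℕ → Matrix (Fin N) (Fin N) ℝ)
    (hPsymm : ∀ r : ℕ, (Pproj r)ᵀ = Pproj r)
    (hPidem : ∀ r : ℕ, Pproj r * Pproj r = Pproj r)
    (hPrange : ∀ r : ℕ, ∀ x : Fin N → ℝ, (Hmat (σ r)).mulVec ((Pproj r).mulVec x) = 0)
    (hPfix : ∀ r : ℕ, ∀ x : Fin N → ℝ,
      (Hmat (σ r)).mulVec x = 0 → (Pproj r).mulVec x = x)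
    (δ : ℝ) (hδ : δ = ⨆ k : ℕ, opNorm (descProd Pproj (j k) (j (k + 1))))
    (hδ0 : 0 < δ) (hδ1 : δ < 1)
    (A : Matrix (Fin n) (Fin n) ℝ) (B : Matrix (Fin n) (Fin m) ℝ)
    (hctrb : (ctrbMatrix A B).rank = n)
    (hspec : ∀ μ : ℂ,
      (∃ v : Fin n → ℂ, v ≠ 0 ∧ (A.map (Complex.ofReal)).mulVec v = μ • v) →
        μ.re < -(Real.log δ) / Tc) :
    ∃ K : Matrix (Fin m) (Fin n) ℝ, ∃ C ϱ : ℝ, 0 < C ∧ 0 < ϱ ∧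
      ∀ xbar : ℝ → (Fin N × Fin n → ℝ),
        (∀ r : ℕ, ∀ s ∈ Set.Ico (ts r) (ts (r + 1)),
          HasDerivWithinAt xbar
            ((((1 : Matrix (Fin N) (Fin N) ℝ) ⊗ₖ A -
                Hmat (σ r) ⊗ₖ (B * K))).mulVec (xbar s))
            (Set.Ici (0 : ℝ)) s) →
        ∀ t : ℝ, 0 ≤ t →
          eNorm (xbar t) ≤ C * Real.exp (-ϱ * t) * eNorm (xbar 0) := by
  have hHpsd : ∀ p, (Hmat p).PosSemidef := fun p => by
    rw [hHmat]
    refine posSemidef_lapMatrix_add_diagonal _ fun i => ?_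
    rcases hΔ p i with h | h <;> simp [h]
  have hHt : ∀ p, (Hmat p)ᵀ = Hmat p := fun p => by
    simpa only [Matrix.conjTranspose_eq_transpose_of_trivial] using (hHpsd p).isHermitian.eq
  have hHP := fun r => mul_eq_zero_of_mulVec_mulVec (hHt (σ r)) (hPsymm r) (hPrange r)
  have hβ : 0 < -(Real.log δ) / Tc := div_pos (neg_pos.2 (Real.log_neg hδ0 hδ1)) hTc
  set f := oneKroneckerCLM (Fin N) (Fin n) with hf
  obtain ⟨α, M₀, hα, hαβ, -, hM₀⟩ := Matrix.exists_norm_exp_smul_algHom_le hn A hβ hspec f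
  set M := max M₀ 1
  have hM : ∀ t : ℝ, 0 ≤ t → ‖NormedSpace.exp (t • f A)‖ ≤ M * Real.exp (α * t) := fun t ht =>
    (hM₀ t ht).trans (by gcongr; exact le_max_left _ _)
  have hM1 : 1 ≤ M := le_max_right _ _
  have hδα : δ * Real.exp (α * Tc) < 1 := by
    have h1 : α * Tc < -Real.log δ := (lt_div_iff₀ hTc).1 hαβ
    calc δ * Real.exp (α * Tc) = Real.exp (Real.log δ + α * Tc) := by
          rw [Real.exp_add, Real.exp_log hδ0]
      _ < 1 := Real.exp_lt_one_iff.2 (by linarith)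
  set L := ⌈Tc / τ⌉₊
  have hL : Tc ≤ L * τ := (div_le_iff₀ hτ).1 (Nat.le_ceil _)
  obtain ⟨ε, hε, hε1, hρ1⟩ := exists_tolerance hδα
    (show 0 ≤ L * M * (Real.exp (α * Tc) + M) ^ L by positivity)
  set ρ := δ * Real.exp (α * Tc) + ε * (L * M * (Real.exp (α * Tc) + M) ^ L)
  have hρ0 : 0 < ρ := by positivity
  obtain ⟨γ, c₁, c₂, S, hγ, hc₁, hc₂, hS₁, hS₂, hric, hcond⟩ :=
    exists_riccati_matrix hn A B hctrb hτ hε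
  have hSt : Sᵀ = S := by
    have h1 := hS₁.isHermitian.eq
    rw [Matrix.conjTranspose_eq_transpose_of_trivial] at h1
    simpa using h1
  obtain ⟨c, hc⟩ := exists_coupling hHpsd
  let K := c • (Bᵀ * S)
  have hbdd : BddAbove (Set.range fun k => opNorm (descProd Pproj (j k) (j (k + 1)))) :=
    ⟨1, by
      rintro _ ⟨k, rfl⟩
      exact opNorm_descProd_le_one hPsymm hPidem (hjmono k.lt_succ_self).le⟩
  have hPP : ∀ r, kroneckerOneCLM (Fin N) (Fin n) (Pproj r) *
      kroneckerOneCLM (Fin N) (Fin n) (Pproj r) = kroneckerOneCLM (Fin N) (Fin n) (Pproj r) :=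
    fun r => by rw [← map_mul, hPidem]
  have hL' : ∀ r, ‖f A - toEuclideanCLM (𝕜 := ℝ) (Hmat (σ r) ⊗ₖ (B * K))‖ ≤
      ∑ p, ‖f A - toEuclideanCLM (𝕜 := ℝ) (Hmat p ⊗ₖ (B * K))‖ := fun r =>
    Finset.single_le_sum (f := fun p => ‖f A - toEuclideanCLM (𝕜 := ℝ) (Hmat p ⊗ₖ (B * K))‖)
      (fun _ _ => norm_nonneg _) (Finset.mem_univ (σ r))
  refine ⟨K, Real.exp ((∑ p, ‖f A - toEuclideanCLM (𝕜 := ℝ) (Hmat p ⊗ₖ (B * K))‖) * Tc) * M / ρ,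
    -Real.log ρ / Tc, by positivity, div_pos (neg_pos.2 (Real.log_neg hρ0 hρ1)) hTc,
    fun xbar hx t ht => ?_⟩
  rw [eNorm_eq_norm_toLp, eNorm_eq_norm_toLp]
  refine norm_le_exp_of_switched (a := f A) (S := f S) (x := fun u => WithLp.toLp 2 (xbar u))
    (h := fun r => toEuclideanCLM (𝕜 := ℝ) (Hmat (σ r) ⊗ₖ (B * K)))
    (P := fun r => kroneckerOneCLM (Fin N) (Fin n) (Pproj r)) hα hM1 hM
    (fun r => commute_kroneckerOneCLM_oneKroneckerCLM _ _)
    (fun r => kroneckerOneCLM_mul_eq_zero (hHP r).2 _)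
    (fun r => mul_kroneckerOneCLM_eq_zero (hHP r).1 _) hPP
    (fun r => norm_le_one_of_symm_of_idem (inner_kroneckerOneCLM_of_symm (hPsymm r)) (hPP r))
    (fun r => norm_sub_apply_le_of_symm_of_idem (inner_kroneckerOneCLM_of_symm (hPsymm r)) (hPP r))
    (fun x y => by rw [inner_oneKroneckerCLM_left, hSt])
    hγ hc₁ hc₂ hε.le hε1 (le_inner_oneKroneckerCLM hS₁) (inner_oneKroneckerCLM_le hS₂) hcond
    (fun r z hz => riccati_dissipation hSt hric
      (hc (σ r) (Pproj r) (hPsymm r) (hPidem r) (hHP r).1 (hHP r).2 (hPfix r)) hz)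
    hL' hτ hts0 hdwell hj0 hjmono hTc hTcb hL hρ0 hρ1 (fun k => ?_) (fun r s hs => ?_) ht
  · rw [← map_descProd]
    refine add_le_add (mul_le_mul_of_nonneg_right ?_ (Real.exp_pos _).le) le_rfl
    refine (norm_kroneckerOneCLM_le _).trans ?_
    rw [hδ]
    exact le_ciSup hbdd k
  · have h1 := (hx r s hs).toLp_mulVec
    rwa [map_sub] at h1
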